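/- Let Ω ⊊ ℝ² be an open bounded simply connected set with C^{1,α} boundary for some 0 < α ≤ 1. Then |Ω| ≤ π · R̊_Ω², where R̊_Ω is the boundary distortion radius of Ω. Moreover, if Ω is a disk of radius R, then R̊_Ω = R and equality holds. -/

import Mathlib

open MeasureTheory Metric Set Filter Complex
open scoped ENNReal NNReal Topology Real

noncomputable section

/-- `Ω ⊆ ℝ² = ℂ` has boundary of class `C^{1,α}`: near every boundary point and in
suitable coordinates (a rotation, realized as multiplication by a unimodular complex
number), `Ω` is the open region above the graph of a `C^{1,α}` function. -/
def HasC1AlphaBoundary (α : ℝ≥0) (Ω : Set ℂ) : Prop :=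
  ∀ z ∈ frontier Ω,
    ∃ (U : Set ℂ) (e : ℂ) (g : ℝ → ℝ) (C : ℝ≥0),
      IsOpen U ∧ z ∈ U ∧ ‖e‖ = 1 ∧ ContDiff ℝ 1 g ∧ HolderWith C α (deriv g) ∧
      Ω ∩ U = {w ∈ U | g ((e * w).re) < (e * w).im}

/-- A conformal parametrization of `Ω` by the unit disk, sending `0` to `x₀`, which is
`C¹` up to the closed disk with (continuous extension of the) derivative `f'`. -/
def IsConformalParam (Ω : Set ℂ) (x₀ : ℂ) (f f' : ℂ → ℂ) : Prop :=
  (∀ z ∈ ball (0 : ℂ) 1, HasDerivAt f (f' z) z) ∧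
  ContinuousOn f (closedBall (0 : ℂ) 1) ∧
  ContinuousOn f' (closedBall (0 : ℂ) 1) ∧
  InjOn f (ball (0 : ℂ) 1) ∧
  f '' (ball (0 : ℂ) 1) = Ω ∧
  f 0 = x₀

/-- The boundary distortion radius
`R̊_Ω = inf_{x₀ ∈ Ω} ((1/2π) ∫_{∂𝔻} |f'_{x₀}|² dH¹)^{1/2}`, where `f_{x₀}` is a Riemann
conformal map from the unit disk onto `Ω` with `f_{x₀}(0) = x₀`. -/
def bdryDistortion (Ω : Set ℂ) : ℝ :=
  sInf { r | ∃ x₀ ∈ Ω, ∃ f f' : ℂ → ℂ, IsConformalParam Ω x₀ f f' ∧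
    r = Real.sqrt ((2 * π)⁻¹ * ∫ z in sphere (0 : ℂ) 1, ‖f' z‖ ^ 2 ∂(μH[1])) }



lemma kw_montel {U : Set ℂ} (hU : IsOpen U) (F : ℕ → ℂ → ℂ)
    (hd : ∀ n, DifferentiableOn ℂ (F n) U) (hb : ∀ n, ∀ z ∈ U, ‖F n z‖ ≤ 1)
    (l : Ultrafilter ℕ) : ∃ g : ℂ → ℂ, TendstoLocallyUniformlyOn F g (l : Filter ℕ) U := by
  have hlim : ∀ z : ℂ, ∃ w : ℂ, z ∈ U → Tendsto (fun n => F n z) l (𝓝 w) := by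
    intro z
    by_cases hz : z ∈ U
    · have hc : IsCompact (closedBall (0 : ℂ) 1) := isCompact_closedBall _ _
      have := hc.ultrafilter_le_nhds (l.map (fun n => F n z)) (by
        rw [le_principal_iff, Ultrafilter.coe_map, Filter.mem_map]
        refine Filter.univ_mem' (fun n => ?_)
        simpa using hb n z hz)
      obtain ⟨w, _, hw⟩ := this
      exact ⟨w, fun _ => hw⟩
    · exact ⟨0, fun h => absurd h hz⟩
  choose g hg using hlim
  refine ⟨g, ?_⟩
  rw [Metric.tendstoLocallyUniformlyOn_iff]
  intro ε hε z₀ hz₀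
  obtain ⟨r, hr, hrU⟩ := Metric.isOpen_iff.1 hU z₀ hz₀
  set ρ := r / 3 with hρ
  have hρ0 : 0 < ρ := by positivity
  have hLip : ∀ n, ∀ x ∈ ball z₀ ρ, dist (F n x) (F n z₀) ≤ (1 / ρ) * dist x z₀ := by
    intro n x hx
    have hder : ∀ y ∈ ball z₀ ρ, ‖deriv (F n) y‖ ≤ 1 / ρ := by
      intro y hy
      have hsub : closedBall y ρ ⊆ U := by
        intro w hw
        apply hrU
        rw [mem_ball] at hy ⊢
        rw [mem_closedBall] at hw
        calc dist w z₀ ≤ dist w y + dist y z₀ := dist_triangle _ _ _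
          _ < r := by linarith
      apply norm_deriv_le_of_forall_mem_sphere_norm_le hρ0
      · apply DifferentiableOn.diffContOnCl
        rw [closure_ball _ hρ0.ne']
        exact (hd n).mono hsub
      · intro w hw
        exact hb n w (hsub (sphere_subset_closedBall hw))
    have hconv := (convex_ball z₀ ρ).norm_image_sub_le_of_norm_deriv_le (f := F n) (C := 1/ρ)
      (fun y hy => ((hd n).differentiableAt (hU.mem_nhds (hrU (by
        rw [mem_ball] at hy ⊢; linarith))))) hder (mem_ball_self hρ0) hx
    simpa [dist_eq_norm] using hconv
  set δ := min ρ (ε * ρ / 4) with hδ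
  have hδ0 : 0 < δ := by positivity
  refine ⟨ball z₀ δ, mem_nhdsWithin_of_mem_nhds (ball_mem_nhds _ hδ0), ?_⟩
  have h1 : ∀ᶠ n in (l : Filter ℕ), dist (F n z₀) (g z₀) < ε / 4 :=
    (Metric.tendsto_nhds.1 (hg z₀ hz₀)) _ (by positivity)
  filter_upwards [h1] with n hn x hx
  have hxρ : x ∈ ball z₀ ρ := ball_subset_ball (min_le_left _ _) hx
  have hxU : x ∈ U := hrU (by rw [mem_ball] at hxρ ⊢; linarith)
  have h2 : ∀ m, dist (F m x) (F m z₀) ≤ ε / 4 := by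
    intro m
    refine (hLip m x hxρ).trans ?_
    have : dist x z₀ ≤ ε * ρ / 4 := (mem_ball.1 hx).le.trans (min_le_right _ _)
    calc 1 / ρ * dist x z₀ ≤ 1 / ρ * (ε * ρ / 4) := by gcongr
      _ = ε / 4 := by field_simp
  have h3 : dist (g x) (g z₀) ≤ ε / 4 :=
    le_of_tendsto ((hg x hxU).dist (hg z₀ hz₀)) (Eventually.of_forall h2)
  have h4 := h2 n
  calc dist (g x) (F n x) ≤ dist (g x) (g z₀) + dist (g z₀) (F n z₀) + dist (F n z₀) (F n x) :=
        dist_triangle4 _ _ _ _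
    _ < ε := by rw [dist_comm (g z₀), dist_comm (F n z₀) (F n x)]; linarith

lemma kw_hurwitz {U : Set ℂ} (hU : IsOpen U) (hUc : IsPreconnected U) (F : ℕ → ℂ → ℂ) (g : ℂ → ℂ)
    (l : Filter ℕ) [l.NeBot]
    (hd : ∀ n, DifferentiableOn ℂ (F n) U) (hi : ∀ n, InjOn (F n) U)
    (hg : TendstoLocallyUniformlyOn F g l U) (a : ℂ) (ha : a ∈ U) (hda : deriv g a ≠ 0) :
    InjOn g U := by
  have hgd : DifferentiableOn ℂ g U := hg.differentiableOn (Eventually.of_forall hd) hU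
  have hga : AnalyticOnNhd ℂ g U := hgd.analyticOnNhd hU
  intro z₁ h₁ z₂ h₂ heq
  by_contra hne
  have hev : ∀ᶠ z in 𝓝[≠] z₂, g z ≠ g z₂ := by
    rcases (hga z₂ h₂).eventually_eq_or_eventually_ne (analyticAt_const (v := g z₂)) with h | h
    · exfalso
      have := hga.eqOn_of_preconnected_of_eventuallyEq (g := fun _ => g z₂)
        (fun _ _ => analyticAt_const) hUc h₂ h
      have h5 : g =ᶠ[𝓝 a] fun _ => g z₂ := by
        filter_upwards [hU.mem_nhds ha] with z hz using this hz
      apply hda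
      rw [h5.deriv_eq]; simp
    · exact h
  rw [eventually_nhdsWithin_iff] at hev
  have hz1 : ∀ᶠ z in 𝓝 z₂, z ≠ z₁ := by
    exact isOpen_ne.mem_nhds (Ne.symm hne)
  obtain ⟨r, hr, hball⟩ := Metric.eventually_nhds_iff_ball.1 (hev.and (hz1.and (hU.mem_nhds h₂)))
  set ρ := r / 2
  have hρ : 0 < ρ := by positivity
  have hsub : closedBall z₂ ρ ⊆ ball z₂ r := closedBall_subset_ball (by simp only [ρ]; linarith)
  have hsubU : closedBall z₂ ρ ⊆ U := fun z hz => (hball z (hsub hz)).2.2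
  obtain ⟨ε, hε, hεs⟩ : ∃ ε > 0, ∀ z ∈ sphere z₂ ρ, ε ≤ ‖g z - g z₂‖ := by
    have hc : ContinuousOn (fun z => ‖g z - g z₂‖) (sphere z₂ ρ) :=
      ((hgd.continuousOn.mono (sphere_subset_closedBall.trans hsubU)).sub continuousOn_const).norm
    obtain ⟨w, hw, hmin⟩ := (isCompact_sphere z₂ ρ).exists_isMinOn
      (NormedSpace.sphere_nonempty.2 hρ.le) hc
    refine ⟨‖g w - g z₂‖, ?_, fun z hz => hmin hz⟩
    rw [gt_iff_lt, norm_pos_iff, sub_ne_zero]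
    apply (hball w (hsub (sphere_subset_closedBall hw))).1
    intro h
    rw [mem_singleton_iff] at h
    rw [h] at hw
    simp at hw
    exact hρ.ne hw
  have hunif := (tendstoLocallyUniformlyOn_iff_forall_isCompact hU).1 hg _ hsubU
    (isCompact_closedBall z₂ ρ)
  have e1 := Metric.tendstoUniformlyOn_iff.1 hunif (ε / 8) (by positivity)
  have e2 := Metric.tendsto_nhds.1 (hg.tendsto_at h₁) (ε / 8) (by positivity)
  obtain ⟨n, hn1, hn2⟩ := (e1.and e2).exists
  have hz2 := hn1 z₂ (mem_closedBall_self hρ.le)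
  have key := DiffContOnCl.ball_subset_image_closedBall (f := F n) (z₀ := z₂) (r := ρ) (ε := ε / 2)
    (by
      apply DifferentiableOn.diffContOnCl
      rw [closure_ball _ hρ.ne']
      exact (hd n).mono hsubU) hρ (by
      intro z hz
      have h6 := hεs z hz
      have h7 := hn1 z (sphere_subset_closedBall hz)
      rw [← dist_eq_norm] at h6 ⊢
      have := dist_triangle4 (g z) (F n z) (F n z₂) (g z₂)
      rw [dist_comm (g z₂)] at hz2
      linarith) (by
      have : ∀ᶠ z in 𝓝[≠] z₂, F n z ≠ F n z₂ := by
        rw [eventually_nhdsWithin_iff]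
        filter_upwards [hU.mem_nhds h₂] with z hz hzne h
        exact hzne (hi n hz h₂ h)
      exact (this.frequently).filter_mono nhdsWithin_le_nhds)
  have hmem : F n z₁ ∈ ball (F n z₂) (ε / 2 / 2) := by
    rw [mem_ball]
    have := dist_triangle (F n z₁) (g z₁) (F n z₂)
    rw [heq] at this hn2
    linarith
  obtain ⟨z, hz, hzeq⟩ := key hmem
  exact (hball z (hsub hz)).2.1 (hi n (hsubU hz) h₁ hzeq)

lemma kw_inj_open {U : Set ℂ} (hU : IsOpen U) {g : ℂ → ℂ} (hg : DifferentiableOn ℂ g U)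
    (hi : InjOn g U) {z : ℂ} (hz : z ∈ U) : 𝓝 (g z) ≤ map g (𝓝 z) := by
  rcases ((hg.analyticOnNhd hU) z hz).eventually_constant_or_nhds_le_map_nhds with h | h
  · exfalso
    have h2 : ∀ᶠ w in 𝓝[≠] z, False := by
      rw [eventually_nhdsWithin_iff]
      filter_upwards [h, hU.mem_nhds hz] with w hw hwU hne
      exact hne (hi hwU hz hw)
    obtain ⟨_, h3⟩ := h2.exists
    exact h3
  · exact h

lemma kw_inv_cont {U : Set ℂ} (hU : IsOpen U) {g f : ℂ → ℂ} (hg : DifferentiableOn ℂ g U)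
    (hi : InjOn g U) (hf : ∀ z ∈ U, f (g z) = z) {z : ℂ} (hz : z ∈ U) : ContinuousAt f (g z) := by
  rw [ContinuousAt, hf z hz]
  refine (Filter.map_mono (kw_inj_open hU hg hi hz)).trans ?_
  rw [Filter.map_map]
  have : (f ∘ g) =ᶠ[𝓝 z] id := by
    filter_upwards [hU.mem_nhds hz] with w hw using hf w hw
  rw [Filter.map_congr this, Filter.map_id]

lemma kw_deriv_ne {U : Set ℂ} (hU : IsOpen U) {g : ℂ → ℂ} (hg : DifferentiableOn ℂ g U)
    (hi : InjOn g U) {z : ℂ} (hz : z ∈ U) : deriv g z ≠ 0 := by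
  set f := Function.invFunOn g U
  have hf : ∀ w ∈ U, f (g w) = w := fun w hw => hi.leftInvOn_invFunOn hw
  have hga := hg.analyticOnNhd hU
  have hder : ∀ᶠ w in 𝓝[≠] z, deriv g w ≠ 0 := by
    rcases (hga z hz).deriv.eventually_eq_zero_or_eventually_ne_zero with h | h
    · exfalso
      obtain ⟨r, hr, hb⟩ := Metric.eventually_nhds_iff_ball.1 (h.and (hU.mem_nhds hz))
      have : ∀ᶠ w in 𝓝[≠] z, False := by
        rw [eventually_nhdsWithin_iff]
        filter_upwards [ball_mem_nhds z hr] with w hw hne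
        have := (convex_ball z r).norm_image_sub_le_of_norm_deriv_le (f := g) (C := 0)
          (fun y hy => hg.differentiableAt (hU.mem_nhds (hb y hy).2))
          (fun y hy => by simp [(hb y hy).1]) (mem_ball_self hr) hw
        have h0 : g w = g z := by
          rw [← sub_eq_zero, ← norm_le_zero_iff]; simpa using this
        exact hne (hi (hb w hw).2 hz h0)
      obtain ⟨_, h3⟩ := this.exists
      exact h3
    · exact h
  rw [eventually_nhdsWithin_iff] at hder
  obtain ⟨r, hr, hb⟩ := Metric.eventually_nhds_iff_ball.1 (hder.and (hU.mem_nhds hz))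
  have hV : g '' ball z r ∈ 𝓝 (g z) :=
    kw_inj_open hU hg hi hz (image_mem_map (ball_mem_nhds z hr))
  have hdf : ∀ w ∈ U, deriv g w ≠ 0 → HasDerivAt f (deriv g w)⁻¹ (g w) := by
    intro w hw hne
    apply HasDerivAt.of_local_left_inverse (f := g) (kw_inv_cont hU hg hi hf hw)
    · rw [hf w hw]
      exact (hg.differentiableAt (hU.mem_nhds hw)).hasDerivAt
    · exact hne
    · have : g '' U ∈ 𝓝 (g w) := kw_inj_open hU hg hi hw (image_mem_map (hU.mem_nhds hw))
      filter_upwards [this]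
      rintro _ ⟨y, hy, rfl⟩
      rw [hf y hy]
  have hfd : DifferentiableOn ℂ f (g '' ball z r) := by
    rw [← Complex.differentiableOn_compl_singleton_and_continuousAt_iff hV]
    refine ⟨?_, kw_inv_cont hU hg hi hf hz⟩
    rintro _ ⟨⟨w, hw, rfl⟩, hne⟩
    have hwz : w ≠ z := fun h => hne (by simp [h])
    exact (hdf w (hb w hw).2 ((hb w hw).1 hwz)).differentiableAt.differentiableWithinAt
  have h1 : HasDerivAt f (deriv f (g z)) (g z) := (hfd.differentiableAt hV).hasDerivAt
  have h2 : HasDerivAt g (deriv g z) z := (hg.differentiableAt (hU.mem_nhds hz)).hasDerivAt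
  have h3 := h1.comp z h2
  have h4 : (f ∘ g) =ᶠ[𝓝 z] id := by
    filter_upwards [hU.mem_nhds hz] with w hw using hf w hw
  have h5 := (h3.congr_of_eventuallyEq h4.symm).unique (hasDerivAt_id z)
  intro h0
  rw [h0] at h5
  simp at h5


lemma kw_log {U : Set ℂ} (hU : IsOpen U) (hsc : IsSimplyConnected U) {G : ℂ → ℂ}
    (hG : DifferentiableOn ℂ G U) (h0 : ∀ z ∈ U, G z ≠ 0) :
    ∃ L : ℂ → ℂ, DifferentiableOn ℂ L U ∧ ∀ z ∈ U, exp (L z) = G z := by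
  obtain ⟨L, hLc, hL⟩ := Complex.exists_continuousOn_eqOn_exp_comp hsc hU hG.continuousOn
    (by rintro ⟨z, hz, h⟩; exact h0 z hz h)
  refine ⟨L, ?_, fun z hz => hL hz⟩
  intro z hz
  have hs := Complex.hasStrictDerivAt_exp (L z)
  have hne : exp (L z) ≠ 0 := exp_ne_zero _
  have h1 := hs.hasStrictFDerivAt_equiv hne
  have hinv : ∀ᶠ y in 𝓝 (L z), h1.localInverse _ _ _ (exp y) = y := h1.eventually_left_inverse
  have hLz : ContinuousAt L z := hLc.continuousAt (hU.mem_nhds hz)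
  have h2 := hLz.eventually hinv
  have h3 : L =ᶠ[𝓝 z] fun w => h1.localInverse _ _ _ (G w) := by
    filter_upwards [h2, hU.mem_nhds hz] with w hw hwU
    rw [← hL hwU]
    exact hw.symm
  have h4' := h1.to_localInverse.hasFDerivAt.differentiableAt
  generalize h1.localInverse _ _ _ = q at h3 h4'
  have h4 : DifferentiableAt ℂ q (G z) := by
    rwa [show exp (L z) = G z from hL hz] at h4'
  have h5 : DifferentiableAt ℂ (fun w => q (G w)) z :=
    h4.comp z (hG.differentiableAt (hU.mem_nhds hz))
  exact (h5.congr_of_eventuallyEq h3).differentiableWithinAt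

def kwMob (w z : ℂ) : ℂ := (z - w) / (1 - (starRingEnd ℂ) w * z)

lemma kwMob_den_ne {w z : ℂ} (hw : ‖w‖ < 1) (hz : ‖z‖ < 1) : 1 - (starRingEnd ℂ) w * z ≠ 0 := by
  intro h
  have h1 : (starRingEnd ℂ) w * z = 1 := by linear_combination -h
  have h2 : ‖w‖ * ‖z‖ = 1 := by
    have := congrArg norm h1
    simpa using this
  nlinarith [norm_nonneg w, norm_nonneg z]

lemma kwMob_norm_lt {w z : ℂ} (hw : ‖w‖ < 1) (hz : ‖z‖ < 1) : ‖kwMob w z‖ < 1 := by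
  have hd := kwMob_den_ne hw hz
  rw [kwMob, norm_div, div_lt_one (norm_pos_iff.2 hd)]
  apply lt_of_pow_lt_pow_left₀ 2 (norm_nonneg _)
  have key : ‖1 - (starRingEnd ℂ) w * z‖ ^ 2 - ‖z - w‖ ^ 2 = (1 - ‖w‖ ^ 2) * (1 - ‖z‖ ^ 2) := by
    simp only [Complex.sq_norm, Complex.normSq_apply, sub_re, sub_im, mul_re, mul_im, conj_re,
      conj_im, one_re, one_im]
    ring
  have : 0 < (1 - ‖w‖ ^ 2) * (1 - ‖z‖ ^ 2) := by
    apply mul_pos <;> nlinarith [norm_nonneg w, norm_nonneg z]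
  linarith

lemma kwMob_hasDerivAt {w z : ℂ} (hw : ‖w‖ < 1) (hz : ‖z‖ < 1) :
    HasDerivAt (kwMob w) ((1 - (starRingEnd ℂ) w * w) / (1 - (starRingEnd ℂ) w * z) ^ 2) z := by
  have hd := kwMob_den_ne hw hz
  have h1 : HasDerivAt (fun z : ℂ => z - w) 1 z := (hasDerivAt_id z).sub_const w
  have h2 : HasDerivAt (fun z : ℂ => 1 - (starRingEnd ℂ) w * z) (-((starRingEnd ℂ) w * 1)) z :=
    ((hasDerivAt_id z).const_mul _).const_sub 1
  have h3 := h1.fun_div h2 hd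
  have e : (1 - (starRingEnd ℂ) w * w) / (1 - (starRingEnd ℂ) w * z) ^ 2 =
      (1 * (1 - (starRingEnd ℂ) w * z) - (z - w) * (-((starRingEnd ℂ) w * 1))) /
      (1 - (starRingEnd ℂ) w * z) ^ 2 := by
    congr 1
    ring
  rw [e]
  exact h3

lemma kwMob_inj {w z z' : ℂ} (hw : ‖w‖ < 1) (hz : ‖z‖ < 1) (hz' : ‖z'‖ < 1)
    (h : kwMob w z = kwMob w z') : z = z' := by
  have hd := kwMob_den_ne hw hz
  have hd' := kwMob_den_ne hw hz'
  rw [kwMob, kwMob, div_eq_div_iff hd hd'] at h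
  have hw2 : (1 - (starRingEnd ℂ) w * w) ≠ 0 := kwMob_den_ne hw hw
  have : (z - z') * (1 - (starRingEnd ℂ) w * w) = 0 := by linear_combination h
  rcases mul_eq_zero.1 this with h | h
  · linear_combination h
  · exact absurd h hw2

lemma kwMob_ne_zero {w z : ℂ} (hw : ‖w‖ < 1) (hz : ‖z‖ < 1) (h : z ≠ w) : kwMob w z ≠ 0 :=
  div_ne_zero (sub_ne_zero.2 h) (kwMob_den_ne hw hz)

/-- Koebe's square root trick. -/
lemma kw_koebe {Ω : Set ℂ} (hΩ : IsOpen Ω) (hsc : IsSimplyConnected Ω) {a : ℂ} (ha : a ∈ Ω)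
    {g : ℂ → ℂ} (hg : DifferentiableOn ℂ g Ω) (hi : InjOn g Ω) (hb : ∀ z ∈ Ω, ‖g z‖ < 1)
    (hga : g a = 0) {w : ℂ} (hw : ‖w‖ < 1) (hwn : ∀ z ∈ Ω, g z ≠ w) :
    ∃ h : ℂ → ℂ, DifferentiableOn ℂ h Ω ∧ InjOn h Ω ∧ (∀ z ∈ Ω, ‖h z‖ < 1) ∧ h a = 0 ∧
      ‖deriv g a‖ < ‖deriv h a‖ := by
  have hGd : DifferentiableOn ℂ (fun z => kwMob w (g z)) Ω := fun z hz =>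
    ((kwMob_hasDerivAt hw (hb z hz)).differentiableAt.comp z
      (hg.differentiableAt (hΩ.mem_nhds hz))).differentiableWithinAt
  obtain ⟨L, hL, hLe⟩ := kw_log hΩ hsc hGd (fun z hz => kwMob_ne_zero hw (hb z hz) (hwn z hz))
  set k : ℂ → ℂ := fun z => exp (L z / 2) with hk
  have hk2 : ∀ z ∈ Ω, k z ^ 2 = kwMob w (g z) := by
    intro z hz
    rw [← hLe z hz, hk, ← Complex.exp_nat_mul]
    congr 1
    push_cast; ring
  have hkd : DifferentiableOn ℂ k Ω := (hL.div_const 2).cexp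
  have hkb : ∀ z ∈ Ω, ‖k z‖ < 1 := by
    intro z hz
    have h1 := kwMob_norm_lt hw (hb z hz)
    rw [← hk2 z hz, norm_pow] at h1
    nlinarith [norm_nonneg (k z)]
  have hki : InjOn k Ω := by
    intro x hx y hy hxy
    apply hi hx hy
    apply kwMob_inj hw (hb x hx) (hb y hy)
    rw [← hk2 x hx, ← hk2 y hy, hxy]
  have hka := hkb a ha
  have hhd : ∀ z ∈ Ω, HasDerivAt (fun z => kwMob (k a) (k z)) (((1 - (starRingEnd ℂ) (k a) * k a) /
      (1 - (starRingEnd ℂ) (k a) * k z) ^ 2) * deriv k z) z := fun z hz =>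
    (kwMob_hasDerivAt hka (hkb z hz)).comp z (hkd.differentiableAt (hΩ.mem_nhds hz)).hasDerivAt
  refine ⟨fun z => kwMob (k a) (k z), fun z hz => (hhd z hz).differentiableAt.differentiableWithinAt,
    fun x hx y hy hxy => hki hx hy (kwMob_inj hka (hkb x hx) (hkb y hy) hxy),
    fun z hz => kwMob_norm_lt hka (hkb z hz), by simp [kwMob], ?_⟩
  rw [(hhd a ha).deriv]
  have hg0 : deriv g a ≠ 0 := kw_deriv_ne hΩ hg hi ha
  have e1 : HasDerivAt (fun z => k z ^ 2) (2 * k a * deriv k a) a := by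
    have := (hkd.differentiableAt (hΩ.mem_nhds ha)).hasDerivAt.pow 2
    simpa [Function.comp_def, Pi.pow_def] using this
  have e2 : HasDerivAt (fun z => kwMob w (g z)) ((1 - (starRingEnd ℂ) w * w) * deriv g a) a := by
    have := (kwMob_hasDerivAt hw (hb a ha)).comp a (hg.differentiableAt (hΩ.mem_nhds ha)).hasDerivAt
    rw [hga] at this
    simpa [Function.comp_def] using this
  have e3 : (fun z => kwMob w (g z)) =ᶠ[𝓝 a] fun z => k z ^ 2 := by
    filter_upwards [hΩ.mem_nhds ha] with z hz using (hk2 z hz).symm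
  have e4 := (e1.congr_of_eventuallyEq e3).unique e2
  have hcw : ∀ u : ℂ, (starRingEnd ℂ) u * u = ((‖u‖ ^ 2 : ℝ) : ℂ) := by
    intro u
    rw [mul_comm, Complex.mul_conj, Complex.normSq_eq_norm_sq]
  rw [hcw, norm_mul]
  rw [hcw] at e4
  have hkw : ‖k a‖ ^ 2 = ‖w‖ := by
    rw [← norm_pow, hk2 a ha, hga]; simp [kwMob]
  set t := ‖k a‖ with ht
  have ht1 : t < 1 := hka
  have ht0 : 0 < t := norm_pos_iff.2 (exp_ne_zero _)
  have e5 : 2 * t * ‖deriv k a‖ = (1 - t ^ 4) * ‖deriv g a‖ := by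
    have := congrArg norm e4
    rw [norm_mul, norm_mul, norm_mul, ← hkw] at this
    rw [show (1 : ℂ) - (((t ^ 2) ^ 2 : ℝ) : ℂ) = ((1 - t ^ 4 : ℝ) : ℂ) by push_cast; ring,
      Complex.norm_real, Real.norm_of_nonneg (by
        have : t ^ 4 < 1 := pow_lt_one₀ ht0.le ht1 (by norm_num)
        linarith)] at this
    simpa using this
  have ht2 : t ^ 2 < 1 := pow_lt_one₀ ht0.le ht1 (by norm_num)
  have e6 : ‖(1 - ((t ^ 2 : ℝ) : ℂ)) / (1 - ((t ^ 2 : ℝ) : ℂ)) ^ 2‖ = (1 - t ^ 2)⁻¹ := by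
    have hne : (1 - ((t ^ 2 : ℝ) : ℂ)) ≠ 0 := by
      rw [← Complex.ofReal_one, ← Complex.ofReal_sub]
      exact_mod_cast (by linarith : (1 - t ^ 2) ≠ 0 )
    rw [show (1 - ((t ^ 2 : ℝ) : ℂ)) / (1 - ((t ^ 2 : ℝ) : ℂ)) ^ 2 = (((1 - t ^ 2)⁻¹ : ℝ) : ℂ) by
      push_cast at hne ⊢; field_simp, Complex.norm_real, Real.norm_of_nonneg (by
        apply inv_nonneg.2; linarith)]
  rw [e6]
  have hgp : 0 < ‖deriv g a‖ := norm_pos_iff.2 hg0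
  have e7 : ‖deriv k a‖ = (1 - t ^ 4) * ‖deriv g a‖ / (2 * t) := by
    field_simp; linarith
  rw [e7]
  have e8 : (1 - t ^ 2)⁻¹ * ((1 - t ^ 4) * ‖deriv g a‖ / (2 * t)) = (1 + t ^ 2) / (2 * t) * ‖deriv g a‖ := by
    have : 1 - t ^ 2 ≠ 0 := by linarith
    field_simp
    ring
  rw [e8]
  have : 1 < (1 + t ^ 2) / (2 * t) := by
    rw [lt_div_iff₀ (by positivity)]; nlinarith [sq_pos_of_pos (sub_pos.2 ht1)]
  nlinarith

theorem kw_riemann {Ω : Set ℂ} (hΩ : IsOpen Ω) (hbd : Bornology.IsBounded Ω)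
    (hsc : IsSimplyConnected Ω) :
    ∃ φ f : ℂ → ℂ, DifferentiableOn ℂ φ Ω ∧ DifferentiableOn ℂ f (ball 0 1) ∧
      (∀ z ∈ Ω, ‖φ z‖ < 1) ∧ (∀ z ∈ Ω, f (φ z) = z) ∧ (∀ z ∈ ball (0 : ℂ) 1, f z ∈ Ω) ∧
      (∀ z ∈ ball (0 : ℂ) 1, φ (f z) = z) := by
  obtain ⟨a, ha⟩ := hsc.nonempty
  set S : Set (ℂ → ℂ) := {g | DifferentiableOn ℂ g Ω ∧ InjOn g Ω ∧ (∀ z ∈ Ω, ‖g z‖ < 1) ∧ g a = 0}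
    with hS
  set A : Set ℝ := (fun g => ‖deriv g a‖) '' S with hA
  have hSne : S.Nonempty := by
    obtain ⟨M, hM⟩ := hbd.exists_norm_le
    have hM0 : 0 ≤ M := (norm_nonneg a).trans (hM a ha)
    have hc : (((2 * M + 1)⁻¹ : ℝ) : ℂ) ≠ 0 := by
      exact_mod_cast (by positivity : (2 * M + 1)⁻¹ ≠ 0)
    refine ⟨fun z => (((2 * M + 1)⁻¹ : ℝ) : ℂ) * (z - a), ?_, ?_, ?_, by simp⟩
    · fun_prop
    · intro x _ y _ hxy
      have := mul_left_cancel₀ hc hxy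
      linear_combination this
    · intro z hz
      rw [norm_mul, Complex.norm_real, Real.norm_of_nonneg (by positivity)]
      rw [inv_mul_lt_iff₀ (by positivity)]
      have := norm_sub_le z a
      linarith [hM z hz, hM a ha]
  have hAne : A.Nonempty := hSne.image _
  obtain ⟨r, hr, hrΩ⟩ := Metric.isOpen_iff.1 hΩ a ha
  have hAb : BddAbove A := by
    refine ⟨1 / (r / 2), ?_⟩
    rintro _ ⟨g, ⟨hg, -, hb, -⟩, rfl⟩
    have hsub : closedBall a (r / 2) ⊆ Ω := (closedBall_subset_ball (by linarith)).trans hrΩ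
    apply norm_deriv_le_of_forall_mem_sphere_norm_le (by positivity)
    · apply DifferentiableOn.diffContOnCl
      rw [closure_ball _ (by positivity)]
      exact hg.mono hsub
    · intro z hz
      exact (hb z (hsub (sphere_subset_closedBall hz))).le
  obtain ⟨u, -, hu, huA⟩ := exists_seq_tendsto_sSup hAne hAb
  choose F hFS hFu using huA
  set l : Ultrafilter ℕ := Filter.hyperfilter ℕ
  have hl : (l : Filter ℕ) ≤ atTop := by
    rw [← Nat.cofinite_eq_atTop]; exact hyperfilter_le_cofinite
  obtain ⟨g, hg⟩ := kw_montel hΩ F (fun n => (hFS n).1) (fun n z hz => ((hFS n).2.2.1 z hz).le) l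
  have hgd : DifferentiableOn ℂ g Ω :=
    hg.differentiableOn (Eventually.of_forall fun n => (hFS n).1) hΩ
  have hgs : ‖deriv g a‖ = sSup A := by
    have h1 := ((hg.deriv (Eventually.of_forall fun n => (hFS n).1) hΩ).tendsto_at ha).norm
    have h2 : Tendsto u l (𝓝 (sSup A)) := hu.mono_left hl
    refine tendsto_nhds_unique h1 (h2.congr fun n => ?_)
    exact (hFu n).symm
  have hpos : 0 < sSup A := by
    obtain ⟨g₀, hg₀⟩ := hSne
    exact (norm_pos_iff.2 (kw_deriv_ne hΩ hg₀.1 hg₀.2.1 ha)).trans_le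
      (le_csSup hAb ⟨g₀, hg₀, rfl⟩)
  have hgi : InjOn g Ω := kw_hurwitz hΩ hsc.isPathConnected.isConnected.isPreconnected F g l
    (fun n => (hFS n).1) (fun n => (hFS n).2.1) hg a ha (by
      rw [← norm_pos_iff, hgs]; exact hpos)
  have hga : g a = 0 := by
    refine tendsto_nhds_unique (hg.tendsto_at ha) ?_
    simp only [fun n => (hFS n).2.2.2]
    exact tendsto_const_nhds
  have hgb : ∀ z ∈ Ω, ‖g z‖ ≤ 1 := fun z hz =>
    le_of_tendsto (hg.tendsto_at hz).norm (Eventually.of_forall fun n => ((hFS n).2.2.1 z hz).le)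
  have hgb' : ∀ z ∈ Ω, ‖g z‖ < 1 := by
    intro z hz
    have h1 : closedBall (0 : ℂ) 1 ∈ 𝓝 (g z) := by
      apply kw_inj_open hΩ hgd hgi hz
      rw [Filter.mem_map]
      filter_upwards [hΩ.mem_nhds hz] with w hw
      simpa using hgb w hw
    rw [← mem_interior_iff_mem_nhds, interior_closedBall _ one_ne_zero] at h1
    simpa using h1
  have hsurj : ∀ w ∈ ball (0 : ℂ) 1, ∃ z ∈ Ω, g z = w := by
    intro w hw
    by_contra hcon
    push Not at hcon
    obtain ⟨h, h1, h2, h3, h4, h5⟩ := kw_koebe hΩ hsc ha hgd hgi hgb' hga (by simpa using hw) hcon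
    have : ‖deriv h a‖ ≤ sSup A := le_csSup hAb ⟨h, ⟨h1, h2, h3, h4⟩, rfl⟩
    linarith
  set f := Function.invFunOn g Ω
  have hf : ∀ w ∈ Ω, f (g w) = w := fun w hw => hgi.leftInvOn_invFunOn hw
  refine ⟨g, f, hgd, ?_, hgb', hf, ?_, ?_⟩
  · intro w hw
    obtain ⟨z, hz, rfl⟩ := hsurj w hw
    apply DifferentiableAt.differentiableWithinAt
    apply HasDerivAt.differentiableAt (f' := (deriv g z)⁻¹)
    apply HasDerivAt.of_local_left_inverse (f := g) (kw_inv_cont hΩ hgd hgi hf hz)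
    · rw [hf z hz]
      exact (hgd.differentiableAt (hΩ.mem_nhds hz)).hasDerivAt
    · exact kw_deriv_ne hΩ hgd hgi hz
    · have : g '' Ω ∈ 𝓝 (g z) := kw_inj_open hΩ hgd hgi hz (image_mem_map (hΩ.mem_nhds hz))
      filter_upwards [this]
      rintro _ ⟨y, hy, rfl⟩
      rw [hf y hy]
  · intro w hw
    obtain ⟨z, hz, rfl⟩ := hsurj w hw
    rw [hf z hz]; exact hz
  · intro w hw
    obtain ⟨z, hz, rfl⟩ := hsurj w hw
    rw [hf z hz]


lemma kw_radial {f : ℂ → ℂ} {C γ : ℝ} (hf : DifferentiableOn ℂ f (ball 0 1)) (hC : 0 ≤ C)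
    (hγ : 0 < γ) (hγ1 : γ ≤ 1)
    (hd : ∀ z ∈ ball (0 : ℂ) 1, ‖deriv f z‖ ≤ C * (1 - ‖z‖) ^ (γ - 1))
    {z : ℂ} (hz : z ∈ ball (0 : ℂ) 1) {δ : ℝ} (hδ : 0 ≤ δ) (hδ1 : δ ≤ 1) :
    ‖f z - f (((1 - δ : ℝ) : ℂ) * z)‖ ≤ C / γ * δ ^ γ := by
  have hz1 : ‖z‖ < 1 := by simpa using hz
  have hmem : ∀ t ∈ Icc (0 : ℝ) 1, (t : ℂ) * z ∈ ball (0 : ℂ) 1 := by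
    intro t ht
    rw [mem_ball_zero_iff, norm_mul, Complex.norm_real, Real.norm_of_nonneg ht.1]
    nlinarith [ht.2, norm_nonneg z]
  have hder : ∀ t ∈ Icc (0 : ℝ) 1, HasDerivAt (fun t : ℝ => f ((t : ℂ) * z))
      (deriv f ((t : ℂ) * z) * z) t := by
    intro t ht
    have h1 : HasDerivAt f (deriv f ((t : ℂ) * z)) ((t : ℂ) * z) :=
      (hf.differentiableAt (isOpen_ball.mem_nhds (hmem t ht))).hasDerivAt
    have h2 : HasDerivAt (fun w : ℂ => w * z) z (t : ℂ) := by
      simpa using (hasDerivAt_id (t : ℂ)).mul_const z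
    exact (h1.comp (t : ℂ) h2).comp_ofReal
  set a := 1 - δ with ha
  have ha0 : 0 ≤ a := by linarith
  have hsub : ∀ t ∈ Icc a 1, t ∈ Icc (0 : ℝ) 1 := fun t ht => ⟨ha0.trans ht.1, ht.2⟩
  have hB : ∀ t ∈ Ico a 1, HasDerivAt (fun t : ℝ => C / γ * δ ^ γ - C / γ * (1 - t) ^ γ)
      (C * (1 - t) ^ (γ - 1)) t := by
    intro t ht
    have h1 : HasDerivAt (fun t : ℝ => 1 - t) (-1) t := (hasDerivAt_id t).const_sub 1
    have h2 := h1.rpow_const (p := γ) (Or.inl (by linarith [ht.2] : (1 : ℝ) - t ≠ 0))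
    have h3 := (h2.const_mul (C / γ)).const_sub (C / γ * δ ^ γ)
    have e : C * (1 - t) ^ (γ - 1) = -(C / γ * (-1 * γ * (1 - t) ^ (γ - 1))) := by
      field_simp
    rw [e]; exact h3
  have key := image_norm_le_of_norm_deriv_right_le_deriv_boundary'
    (f := fun t : ℝ => f ((t : ℂ) * z) - f ((a : ℂ) * z)) (a := a) (b := 1)
    (f' := fun t => deriv f ((t : ℂ) * z) * z)
    (B := fun t : ℝ => C / γ * δ ^ γ - C / γ * (1 - t) ^ γ)
    (B' := fun t => C * (1 - t) ^ (γ - 1))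
    (fun t ht => ((hder t (hsub t ht)).sub_const _).continuousAt.continuousWithinAt)
    (fun t ht => ((hder t (hsub t (Ico_subset_Icc_self ht))).sub_const _).hasDerivWithinAt)
    (by simp [ha])
    (by
      apply Continuous.continuousOn
      have : Continuous fun t : ℝ => (1 - t) ^ γ :=
        (continuous_const.sub continuous_id).rpow_const (fun _ => Or.inr hγ.le)
      fun_prop)
    (fun t ht => (hB t ht).hasDerivWithinAt)
    (by
      intro t ht
      have ht' := hsub t (Ico_subset_Icc_self ht)
      have h1 := hd _ (hmem t ht')
      rw [norm_mul, Complex.norm_real, Real.norm_of_nonneg ht'.1] at h1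
      rw [norm_mul]
      have h2 : (1 - t * ‖z‖) ^ (γ - 1) ≤ (1 - t) ^ (γ - 1) := by
        apply Real.rpow_le_rpow_of_nonpos
        · linarith [ht.2]
        · nlinarith [ht'.1]
        · linarith
      calc ‖deriv f (↑t * z)‖ * ‖z‖ ≤ ‖deriv f (↑t * z)‖ * 1 := by gcongr
        _ ≤ C * (1 - t * ‖z‖) ^ (γ - 1) := by rw [mul_one]; exact h1
        _ ≤ _ := by gcongr)
  have := key (x := 1) ⟨by linarith, le_refl _⟩
  simpa [Real.zero_rpow hγ.ne'] using this

lemma kw_hardy_littlewood {f : ℂ → ℂ} {C γ : ℝ} (hf : DifferentiableOn ℂ f (ball 0 1)) (hC : 0 ≤ C)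
    (hγ : 0 < γ) (hγ1 : γ ≤ 1)
    (hd : ∀ z ∈ ball (0 : ℂ) 1, ‖deriv f z‖ ≤ C * (1 - ‖z‖) ^ (γ - 1)) :
    ∀ z ∈ ball (0 : ℂ) 1, ∀ w ∈ ball (0 : ℂ) 1,
      ‖f z - f w‖ ≤ (2 * (C / γ) + C) * ‖z - w‖ ^ γ := by
  intro z hz w hw
  rcases eq_or_ne z w with rfl | hne
  · simp [Real.zero_rpow hγ.ne']
  have hpos : 0 < ‖z - w‖ := norm_pos_iff.2 (sub_ne_zero.2 hne)
  set δ := min 1 ‖z - w‖ with hδ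
  have hδ0 : 0 < δ := by positivity
  have hδ1 : δ ≤ 1 := min_le_left _ _
  have hδ2 : δ ≤ ‖z - w‖ := min_le_right _ _
  have h1 := kw_radial hf hC hγ hγ1 hd hz hδ0.le hδ1
  have h2 := kw_radial hf hC hγ hγ1 hd hw hδ0.le hδ1
  have hpow : δ ^ γ ≤ ‖z - w‖ ^ γ := Real.rpow_le_rpow hδ0.le hδ2 hγ.le
  have hz1 : ‖z‖ < 1 := by simpa using hz
  have hw1 : ‖w‖ < 1 := by simpa using hw
  have hn : ∀ u : ℂ, ‖u‖ < 1 → ((1 - δ : ℝ) : ℂ) * u ∈ closedBall (0 : ℂ) (1 - δ) := by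
    intro u hu
    rw [mem_closedBall_zero_iff, norm_mul, Complex.norm_real, Real.norm_of_nonneg (by linarith)]
    nlinarith
  have hcb : closedBall (0 : ℂ) (1 - δ) ⊆ ball 0 1 := closedBall_subset_ball (by linarith)
  have h3 := (convex_closedBall (0 : ℂ) (1 - δ)).norm_image_sub_le_of_norm_deriv_le (f := f)
    (C := C * δ ^ (γ - 1)) (fun y hy => hf.differentiableAt (isOpen_ball.mem_nhds (hcb hy)))
    (by
      intro y hy
      refine (hd y (hcb hy)).trans ?_
      have : δ ≤ 1 - ‖y‖ := by
        have := mem_closedBall_zero_iff.1 hy; linarith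
      gcongr ?_ * ?_
      exact Real.rpow_le_rpow_of_nonpos hδ0 this (by linarith)) (hn w hw1) (hn z hz1)
  have h4 : C * δ ^ (γ - 1) * ‖((1 - δ : ℝ) : ℂ) * z - ((1 - δ : ℝ) : ℂ) * w‖ ≤ C * ‖z - w‖ ^ γ := by
    rw [← mul_sub, norm_mul, Complex.norm_real, Real.norm_of_nonneg (by linarith)]
    have h5 : δ ^ (γ - 1) * ((1 - δ) * ‖z - w‖) ≤ ‖z - w‖ ^ γ := by
      rcases le_total 1 ‖z - w‖ with h | h
      · have : δ = 1 := by simp [hδ, h]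
        rw [this]; simp; positivity
      · have : δ = ‖z - w‖ := by simp [hδ, h]
        rw [← this, Real.rpow_sub hδ0, Real.rpow_one]
        have : 0 ≤ δ ^ γ := by positivity
        calc δ ^ γ / δ * ((1 - δ) * δ) = δ ^ γ * (1 - δ) := by field_simp
          _ ≤ δ ^ γ * 1 := by gcongr; linarith
          _ = δ ^ γ := mul_one _
    calc _ = C * (δ ^ (γ - 1) * ((1 - δ) * ‖z - w‖)) := by ring
      _ ≤ _ := by gcongr
  have h6 : C / γ * δ ^ γ ≤ C / γ * ‖z - w‖ ^ γ := by gcongr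
  have e : f z - f w = (f z - f (((1 - δ : ℝ) : ℂ) * z)) +
    (f (((1 - δ : ℝ) : ℂ) * z) - f (((1 - δ : ℝ) : ℂ) * w)) -
    (f w - f (((1 - δ : ℝ) : ℂ) * w)) := by ring
  rw [e]
  refine (norm_sub_le _ _).trans ?_
  have := norm_add_le (f z - f (((1 - δ : ℝ) : ℂ) * z))
    (f (((1 - δ : ℝ) : ℂ) * z) - f (((1 - δ : ℝ) : ℂ) * w))
  linarith

lemma kw_extend {f : ℂ → ℂ} {C γ : ℝ} (hγ : 0 < γ) (hC : 0 ≤ C)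
    (h : ∀ z ∈ ball (0 : ℂ) 1, ∀ w ∈ ball (0 : ℂ) 1, ‖f z - f w‖ ≤ C * ‖z - w‖ ^ γ) :
    ∃ F : ℂ → ℂ, ContinuousOn F (closedBall 0 1) ∧ (∀ z ∈ ball (0 : ℂ) 1, F z = f z) ∧
      ∀ z ∈ closedBall (0 : ℂ) 1, ∀ w ∈ closedBall (0 : ℂ) 1, ‖F z - F w‖ ≤ C * ‖z - w‖ ^ γ := by
  have huc : UniformContinuousOn f (ball 0 1) := by
    rw [Metric.uniformContinuousOn_iff]
    intro ε hε
    have ht : Tendsto (fun x : ℝ => C * x ^ γ) (𝓝 0) (𝓝 0) := by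
      have : Continuous fun x : ℝ => C * x ^ γ :=
        continuous_const.mul (continuous_id.rpow_const (fun _ => Or.inr hγ.le))
      have := this.tendsto 0
      simpa [Real.zero_rpow hγ.ne'] using this
    obtain ⟨δ, hδ, hb⟩ := Metric.eventually_nhds_iff.1 (ht.eventually (gt_mem_nhds hε))
    refine ⟨δ, hδ, fun z hz w hw hzw => ?_⟩
    rw [dist_eq_norm] at hzw ⊢
    refine (h z hz w hw).trans_lt (hb ?_)
    simpa using hzw
  have hcl : closedBall (0 : ℂ) 1 ⊆ closure (ball 0 1) := by
    rw [closure_ball _ one_ne_zero]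
  have hlim : ∀ x ∈ closedBall (0 : ℂ) 1, ∃ y, Tendsto f (𝓝[ball 0 1] x) (𝓝 y) := by
    intro x hx
    haveI : (𝓝[ball (0 : ℂ) 1] x).NeBot := mem_closure_iff_nhdsWithin_neBot.1 (hcl hx)
    have hca : Cauchy (map f (𝓝[ball (0 : ℂ) 1] x)) := by
      refine ⟨inferInstance, ?_⟩
      rw [prod_map_map_eq]
      refine Tendsto.mono_left huc ?_
      rw [le_inf_iff]
      constructor
      · exact (Filter.prod_mono nhdsWithin_le_nhds nhdsWithin_le_nhds).trans
          ((nhds_prod_eq (x := x) (y := x)).symm.le.trans (nhds_le_uniformity x))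
      · rw [le_principal_iff]
        exact Filter.prod_mem_prod self_mem_nhdsWithin self_mem_nhdsWithin
    exact CompleteSpace.complete hca
  have hcont := continuousOn_extendFrom hcl hlim
  have hfc : ContinuousOn f (ball 0 1) := huc.continuousOn
  have hext : ∀ z ∈ ball (0 : ℂ) 1, extendFrom (ball 0 1) f z = f z := by
    intro z hz
    exact extendFrom_eq (subset_closure hz) (hfc z hz)
  refine ⟨extendFrom (ball 0 1) f, hcont, hext, ?_⟩
  intro z hz w hw
  have hseq : ∀ u ∈ closedBall (0 : ℂ) 1, Tendsto (fun t : ℝ => (t : ℂ) * u) (𝓝[<] 1)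
      (𝓝[closedBall 0 1] u) ∧ ∀ᶠ t : ℝ in 𝓝[<] 1, (t : ℂ) * u ∈ ball (0 : ℂ) 1 := by
    intro u hu
    have hu1 : ‖u‖ ≤ 1 := by simpa using hu
    have hev : ∀ᶠ t : ℝ in 𝓝[<] 1, (t : ℂ) * u ∈ ball (0 : ℂ) 1 := by
      have : ∀ᶠ t : ℝ in 𝓝[<] 1, t ∈ Ioo (0 : ℝ) 1 := Ioo_mem_nhdsLT one_pos
      filter_upwards [this] with t ht
      rw [mem_ball_zero_iff, norm_mul, Complex.norm_real, Real.norm_of_nonneg ht.1.le]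
      nlinarith [ht.1, ht.2, norm_nonneg u]
    refine ⟨?_, hev⟩
    apply tendsto_nhdsWithin_of_tendsto_nhds_of_eventually_within
    · have : Continuous fun t : ℝ => (t : ℂ) * u := by fun_prop
      have := (this.tendsto 1).mono_left (nhdsWithin_le_nhds (s := Iio 1))
      simpa using this
    · filter_upwards [hev] with t ht using ball_subset_closedBall ht
  obtain ⟨tz, ez⟩ := hseq z hz
  obtain ⟨tw, ew⟩ := hseq w hw
  have l1 := (((hcont z hz).tendsto.comp tz).sub ((hcont w hw).tendsto.comp tw)).norm
  have l2 := (((tz.mono_right nhdsWithin_le_nhds).sub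
    (tw.mono_right nhdsWithin_le_nhds)).norm.rpow_const (p := γ) (Or.inr hγ.le)).const_mul C
  refine le_of_tendsto_of_tendsto l1 l2 ?_
  filter_upwards [ez, ew] with t h1 h2
  simp only [Function.comp_apply]
  rw [hext _ h1, hext _ h2]
  exact h _ h1 _ h2


lemma kw_circleMap_lip : LipschitzWith 1 (circleMap 0 1) := by
  simpa using lipschitzWith_circleMap 0 1

lemma kw_chord {x y : ℝ} (hxy : |x - y| ≤ 1) :
    |x - y| - |x - y| ^ 2 ≤ ‖circleMap 0 1 x - circleMap 0 1 y‖ := by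
  have e : circleMap 0 1 x - circleMap 0 1 y
      = cexp ((y : ℂ) * I) * (cexp (((x - y : ℝ) : ℂ) * I) - 1) := by
    simp only [circleMap, ofReal_one, one_mul, zero_add, mul_sub, mul_one, ← Complex.exp_add]
    congr 2
    push_cast; ring
  rw [e, norm_mul, Complex.norm_exp_ofReal_mul_I, one_mul]
  have hn : ‖((x - y : ℝ) : ℂ) * I‖ = |x - y| := by
    rw [norm_mul, Complex.norm_real, Complex.norm_I, mul_one, Real.norm_eq_abs]
  have h := Complex.norm_exp_sub_one_sub_id_le (x := ((x - y : ℝ) : ℂ) * I) (by rw [hn]; exact hxy)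
  have h2 := norm_sub_norm_le (((x - y : ℝ) : ℂ) * I) (((x - y : ℝ) : ℂ) * I - (cexp (((x - y : ℝ) : ℂ) * I) - 1))
  rw [norm_sub_rev (((x - y : ℝ) : ℂ) * I) (cexp (((x - y : ℝ) : ℂ) * I) - 1)] at h2
  rw [hn] at h h2
  simp only [sub_sub_cancel] at h2
  linarith

lemma kw_arc {a b ε : ℝ} (hab : a ≤ b) (hb : b - a ≤ ε) (hε : 0 ≤ ε) (hε1 : ε < 1) :
    ENNReal.ofReal ((1 - ε) * (b - a)) ≤ μH[1] (circleMap 0 1 '' Ioc a b) := by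
  have hch : ∀ x ∈ Ioc a b, ∀ y ∈ Ioc a b,
      |x - y| * (1 - ε) ≤ ‖circleMap 0 1 x - circleMap 0 1 y‖ := by
    intro x hx y hy
    have h1 : |x - y| ≤ ε := by
      rw [abs_le]; constructor <;> linarith [hx.1, hx.2, hy.1, hy.2]
    have := kw_chord (h1.trans hε1.le)
    nlinarith [abs_nonneg (x - y)]
  have hinj : InjOn (circleMap 0 1) (Ioc a b) := by
    intro x hx y hy hxy
    have := hch x hx y hy
    rw [hxy, sub_self, norm_zero] at this
    have h2 : |x - y| ≤ 0 := by nlinarith [abs_nonneg (x - y)]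
    exact sub_eq_zero.1 (abs_eq_zero.1 (le_antisymm h2 (abs_nonneg _)))
  set g := Function.invFunOn (circleMap 0 1) (Ioc a b)
  have hg : ∀ x ∈ Ioc a b, g (circleMap 0 1 x) = x := fun x hx => hinj.leftInvOn_invFunOn hx
  have hlip : LipschitzOnWith (Real.toNNReal (1 - ε)⁻¹) g (circleMap 0 1 '' Ioc a b) := by
    apply LipschitzOnWith.of_dist_le_mul
    rintro _ ⟨x, hx, rfl⟩ _ ⟨y, hy, rfl⟩
    rw [hg x hx, hg y hy, Real.dist_eq, dist_eq_norm, Real.coe_toNNReal _ (by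
      apply inv_nonneg.2; linarith)]
    rw [inv_mul_eq_div, le_div_iff₀ (by linarith)]
    exact hch x hx y hy
  have h := hlip.hausdorffMeasure_image_le (d := 1) zero_le_one
  have him : g '' (circleMap 0 1 '' Ioc a b) = Ioc a b := by
    rw [image_image]
    ext x; constructor
    · rintro ⟨y, hy, rfl⟩; simp only; rw [hg y hy]; exact hy
    · intro hx; exact ⟨x, hx, hg x hx⟩
  rw [him, hausdorffMeasure_real, Real.volume_Ioc, ENNReal.rpow_one] at h
  rw [ENNReal.ofReal_mul (by linarith)]
  calc _ ≤ ENNReal.ofReal (1 - ε) * (ENNReal.ofReal (1 - ε)⁻¹ * μH[1] (circleMap 0 1 '' Ioc a b)) := by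
        gcongr; exact h
    _ = _ := by
        rw [← mul_assoc, ← ENNReal.ofReal_mul (by linarith), mul_inv_cancel₀ (by linarith)]; simp

lemma kw_inj_circle : InjOn (circleMap 0 1) (Ioc 0 (2 * π)) := by
  have := injOn_circleMap_of_abs_sub_le (a := 0) (b := 2 * π) (R := 1) (c := 0) one_ne_zero
    (by rw [zero_sub, abs_neg, abs_of_nonneg Real.two_pi_pos.le])
  rwa [uIoc_of_le Real.two_pi_pos.le] at this

lemma kw_image_meas {E : Set ℝ} (hE : MeasurableSet E) (hs : E ⊆ Ioc 0 (2 * π)) :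
    MeasurableSet (circleMap 0 1 '' E) :=
  hE.image_of_continuousOn_injOn (continuous_circleMap 0 1).continuousOn (kw_inj_circle.mono hs)

lemma kw_len : ENNReal.ofReal (2 * π) ≤ μH[1] (sphere (0 : ℂ) 1) := by
  by_contra! hlt
  have hfin : μH[1] (sphere (0 : ℂ) 1) ≠ ∞ := (hlt.trans ENNReal.ofReal_lt_top).ne
  have key : ∀ N : ℕ, 7 ≤ N → (1 - 2 * π / N) * (2 * π) ≤ (μH[1] (sphere (0 : ℂ) 1)).toReal := by
    intro N hN
    have hN0 : (0 : ℝ) < N := by exact_mod_cast (by omega : 0 < N)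
    have hN7 : (7 : ℝ) ≤ N := by exact_mod_cast hN
    set d := 2 * π / N with hd
    have hd0 : 0 < d := by positivity
    have hd1 : d < 1 := by rw [hd, div_lt_one hN0]; linarith [Real.pi_lt_d2]
    have hNd : N * d = 2 * π := by rw [hd]; field_simp
    have hsub : ∀ k ∈ Finset.range N, Ioc (k * d) ((k + 1) * d) ⊆ Ioc 0 (2 * π) := by
      intro k hk x hx
      have hk1 : (k : ℝ) + 1 ≤ N := by exact_mod_cast Finset.mem_range.1 hk
      have hk0 : (0 : ℝ) ≤ k := Nat.cast_nonneg k
      constructor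
      · have := hx.1; nlinarith
      · have := hx.2; nlinarith
    have hdis : (↑(Finset.range N) : Set ℕ).PairwiseDisjoint
        (fun k : ℕ => circleMap 0 1 '' Ioc (k * d) ((k + 1) * d)) := by
      intro i hi j hj hij
      have hd2 : Disjoint (Ioc (i * d) ((i + 1) * d)) (Ioc (j * d) ((j + 1) * d)) := by
        rw [Set.disjoint_left]
        intro x hx hy
        rcases lt_or_gt_of_ne hij with h | h
        · have : (i : ℝ) + 1 ≤ j := by exact_mod_cast h
          nlinarith [hx.2, hy.1]
        · have : (j : ℝ) + 1 ≤ i := by exact_mod_cast h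
          nlinarith [hx.1, hy.2]
      rw [Function.onFun, Set.disjoint_left]
      rintro _ ⟨x, hx, rfl⟩ ⟨y, hy, hxy⟩
      have := kw_inj_circle (hsub j hj hy) (hsub i hi hx) hxy
      subst this
      exact Set.disjoint_left.1 hd2 hx hy
    have h1 : μH[1] (⋃ k ∈ Finset.range N, circleMap 0 1 '' Ioc (k * d) ((k + 1) * d))
        ≤ μH[1] (sphere (0 : ℂ) 1) := by
      apply measure_mono
      refine iUnion₂_subset fun k hk => ?_
      rintro _ ⟨x, hx, rfl⟩
      exact circleMap_mem_sphere 0 zero_le_one x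
    rw [measure_biUnion_finset hdis (fun k hk => kw_image_meas measurableSet_Ioc (hsub k hk))] at h1
    have h2 : ∑ k ∈ Finset.range N, ENNReal.ofReal ((1 - d) * d) ≤ μH[1] (sphere (0 : ℂ) 1) := by
      refine le_trans (Finset.sum_le_sum fun k hk => ?_) h1
      have := kw_arc (a := k * d) (b := (k + 1) * d) (ε := d) (by nlinarith) (by linarith) hd0.le hd1
      have e : (k + 1) * d - k * d = d := by ring
      rwa [e] at this
    rw [Finset.sum_const, Finset.card_range, nsmul_eq_mul] at h2
    have h3 := ENNReal.toReal_mono hfin h2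
    rw [ENNReal.toReal_mul, ENNReal.toReal_ofReal (by nlinarith), ENNReal.toReal_natCast] at h3
    calc (1 - d) * (2 * π) = N * ((1 - d) * d) := by rw [← hNd]; ring
      _ ≤ _ := h3
  have hlim : Tendsto (fun N : ℕ => (1 - 2 * π / N) * (2 * π)) atTop (𝓝 ((1 - 0) * (2 * π))) :=
    ((tendsto_const_div_atTop_nhds_zero_nat (2 * π)).const_sub 1).mul_const _
  have h5 := le_of_tendsto hlim (eventually_atTop.2 ⟨7, key⟩)
  rw [sub_zero, one_mul] at h5
  have := (ENNReal.ofReal_le_iff_le_toReal hfin).2 h5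
  exact absurd hlt (not_lt.2 this)

lemma kw_hausdorff : (μH[1] : Measure ℂ).restrict (sphere (0 : ℂ) 1)
    = Measure.map (circleMap 0 1) (volume.restrict (Ioc 0 (2 * π))) := by
  have him := image_circleMap_Ioc 0 1
  rw [abs_one] at him
  have hle : (μH[1] : Measure ℂ).restrict (sphere (0 : ℂ) 1)
      ≤ Measure.map (circleMap 0 1) (volume.restrict (Ioc 0 (2 * π))) := by
    rw [Measure.le_iff]
    intro E hE
    rw [Measure.restrict_apply hE, Measure.map_apply (continuous_circleMap 0 1).measurable hE,
      Measure.restrict_apply ((continuous_circleMap 0 1).measurable hE)]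
    have e : E ∩ sphere 0 1 = circleMap 0 1 '' (circleMap 0 1 ⁻¹' E ∩ Ioc 0 (2 * π)) := by
      rw [← him, image_preimage_inter]
    rw [e]
    have := (kw_circleMap_lip.lipschitzOnWith
      (s := circleMap 0 1 ⁻¹' E ∩ Ioc 0 (2 * π))).hausdorffMeasure_image_le (d := 1) zero_le_one
    rw [hausdorffMeasure_real] at this
    simpa using this
  have hmap : Measure.map (circleMap 0 1) (volume.restrict (Ioc 0 (2 * π))) univ
      = ENNReal.ofReal (2 * π) := by
    rw [Measure.map_apply (continuous_circleMap 0 1).measurable MeasurableSet.univ]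
    simp
  have hfin : IsFiniteMeasure ((μH[1] : Measure ℂ).restrict (sphere (0 : ℂ) 1)) := by
    constructor
    refine (hle univ).trans_lt ?_
    rw [hmap]; exact ENNReal.ofReal_lt_top
  apply Measure.eq_of_le_of_measure_univ_eq hle
  apply le_antisymm (hle univ)
  rw [hmap, Measure.restrict_apply_univ]
  exact kw_len

lemma kw_hausdorff_integral (u : ℂ → ℝ) (hu : ContinuousOn u (sphere 0 1)) :
    ∫ z in sphere (0 : ℂ) 1, u z ∂(μH[1]) = ∫ t in Ioc 0 (2 * π), u (circleMap 0 1 t) := by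
  have hm : AEStronglyMeasurable u ((μH[1] : Measure ℂ).restrict (sphere (0 : ℂ) 1)) :=
    hu.aestronglyMeasurable isClosed_sphere.measurableSet
  rw [kw_hausdorff] at hm ⊢
  exact integral_map (continuous_circleMap 0 1).aemeasurable hm


lemma kw_norm_circle (t : ℝ) : ‖circleMap 0 1 t‖ = 1 := by
  simp [circleMap]

lemma kw_mean_hol {g : ℂ → ℂ} (hg : DifferentiableOn ℂ g (ball 0 1)) {k : ℝ → ℂ}
    (hk : Continuous k) :
    DifferentiableOn ℂ (fun z => ∫ t in (-π)..π, g (z * circleMap 0 1 t) * k t) (ball 0 1) := by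
  intro z₀ hz₀
  have hz1 : ‖z₀‖ < 1 := by simpa using hz₀
  set ρ := (1 - ‖z₀‖) / 2 with hρ
  have hρ0 : 0 < ρ := by rw [hρ]; linarith
  have hmem : ∀ z ∈ ball z₀ ρ, ∀ t, z * circleMap 0 1 t ∈ closedBall (0 : ℂ) (1 - ρ) := by
    intro z hz t
    rw [mem_closedBall_zero_iff, norm_mul, kw_norm_circle, mul_one]
    have h1 : ‖z - z₀‖ < ρ := by simpa [dist_eq_norm] using hz
    have h2 := norm_sub_norm_le z z₀
    linarith
  have hsub : closedBall (0 : ℂ) (1 - ρ) ⊆ ball 0 1 := closedBall_subset_ball (by linarith)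
  have hcd : ContinuousOn (deriv g) (ball 0 1) := (hg.deriv isOpen_ball).continuousOn
  obtain ⟨B, hB⟩ := (isCompact_closedBall (0 : ℂ) (1 - ρ)).exists_bound_of_continuousOn
    (hcd.mono hsub)
  have hcont : ∀ u : ℂ → ℂ, ContinuousOn u (ball 0 1) → ∀ z ∈ ball z₀ ρ,
      Continuous fun t => u (z * circleMap 0 1 t) := by
    intro u hu z hz
    exact hu.comp_continuous (continuous_const.mul (continuous_circleMap 0 1))
      (fun t => hsub (hmem z hz t))
  have key := intervalIntegral.hasDerivAt_integral_of_dominated_loc_of_deriv_le (𝕜 := ℂ)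
    (μ := volume) (a := -π) (b := π) (x₀ := z₀) (s := ball z₀ ρ)
    (F := fun z t => g (z * circleMap 0 1 t) * k t)
    (F' := fun z t => (deriv g (z * circleMap 0 1 t) * circleMap 0 1 t) * k t)
    (bound := fun t => B * ‖k t‖) (ball_mem_nhds _ hρ0)
    (by
      filter_upwards [ball_mem_nhds z₀ hρ0] with z hz
      exact ((hcont g hg.continuousOn z hz).mul hk).aestronglyMeasurable)
    (((hcont g hg.continuousOn z₀ (mem_ball_self hρ0)).mul hk).intervalIntegrable _ _)
    ((((hcont _ hcd z₀ (mem_ball_self hρ0)).mul (continuous_circleMap 0 1)).mul hk).aestronglyMeasurable)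
    (by
      refine Eventually.of_forall fun t _ z hz => ?_
      rw [norm_mul, norm_mul, kw_norm_circle, mul_one]
      exact mul_le_mul_of_nonneg_right (hB _ (hmem z hz t)) (norm_nonneg _))
    ((continuous_const.mul hk.norm).intervalIntegrable _ _)
    (by
      refine Eventually.of_forall fun t _ z hz => ?_
      have h1 : HasDerivAt g (deriv g (z * circleMap 0 1 t)) (z * circleMap 0 1 t) :=
        (hg.differentiableAt (isOpen_ball.mem_nhds (hsub (hmem z hz t)))).hasDerivAt
      have h2 : HasDerivAt (fun w : ℂ => w * circleMap 0 1 t) (circleMap 0 1 t) z := by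
        simpa using (hasDerivAt_id z).mul_const (circleMap 0 1 t)
      exact (h1.comp z h2).mul_const (k t))
  exact key.2.differentiableAt.differentiableWithinAt

lemma kw_mean_cont {g : ℂ → ℂ} (hg : ContinuousOn g (closedBall 0 1)) {k : ℝ → ℂ}
    (hk : Continuous k) :
    ContinuousOn (fun z => ∫ t in (-π)..π, g (z * circleMap 0 1 t) * k t) (closedBall 0 1) := by
  have hmem : ∀ z ∈ closedBall (0 : ℂ) 1, ∀ t, z * circleMap 0 1 t ∈ closedBall (0 : ℂ) 1 := by
    intro z hz t
    rw [mem_closedBall_zero_iff, norm_mul, kw_norm_circle, mul_one]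
    simpa using hz
  obtain ⟨B, hB⟩ := (isCompact_closedBall (0 : ℂ) 1).exists_bound_of_continuousOn hg
  intro z₀ hz₀
  refine intervalIntegral.continuousWithinAt_of_dominated_interval (bound := fun t => B * ‖k t‖)
    ?_ ?_ ((continuous_const.mul hk.norm).intervalIntegrable _ _) ?_
  · filter_upwards [self_mem_nhdsWithin] with z hz
    exact ((hg.comp_continuous (continuous_const.mul (continuous_circleMap 0 1))
      (fun t => hmem z hz t)).mul hk).aestronglyMeasurable
  · filter_upwards [self_mem_nhdsWithin] with z hz
    refine Eventually.of_forall fun t _ => ?_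
    rw [norm_mul]
    exact mul_le_mul_of_nonneg_right (hB _ (hmem z hz t)) (norm_nonneg _)
  · refine Eventually.of_forall fun t _ => ?_
    refine ContinuousWithinAt.mul ?_ continuousWithinAt_const
    exact (hg _ (hmem z₀ hz₀ t)).comp (f := fun z : ℂ => z * circleMap 0 1 t)
      (by fun_prop) (fun z hz => hmem z hz t)

lemma kw_mean {g : ℂ → ℂ} (hg : DifferentiableOn ℂ g (ball 0 1))
    (hgc : ContinuousOn g (closedBall 0 1)) {r : ℝ} (hr0 : 0 ≤ r) (hr : r ≤ 1) :
    ∫ t in (-π)..π, ‖g (r * circleMap 0 1 t)‖ ^ 2 ≤ ∫ t in (-π)..π, ‖g (circleMap 0 1 t)‖ ^ 2 := by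
  have hmem : ∀ z ∈ closedBall (0 : ℂ) 1, ∀ t, z * circleMap 0 1 t ∈ closedBall (0 : ℂ) 1 := by
    intro z hz t
    rw [mem_closedBall_zero_iff, norm_mul, kw_norm_circle, mul_one]
    simpa using hz
  have hrm : (r : ℂ) ∈ closedBall (0 : ℂ) 1 := by
    rw [mem_closedBall_zero_iff, Complex.norm_real, Real.norm_of_nonneg hr0]; exact hr
  have hcz : ∀ z ∈ closedBall (0 : ℂ) 1, Continuous fun t => g (z * circleMap 0 1 t) :=
    fun z hz => hgc.comp_continuous (continuous_const.mul (continuous_circleMap 0 1))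
      (fun t => hmem z hz t)
  set k : ℝ → ℂ := fun t => (starRingEnd ℂ) (g (r * circleMap 0 1 t)) with hk
  have hkc : Continuous k := Complex.continuous_conj.comp (hcz _ hrm)
  have hππ : -π ≤ π := by linarith [Real.pi_pos]
  set M1 := ∫ t in (-π)..π, ‖g (circleMap 0 1 t)‖ ^ 2
  set Mr := ∫ t in (-π)..π, ‖g (r * circleMap 0 1 t)‖ ^ 2
  have hbd : ∀ z ∈ frontier (ball (0 : ℂ) 1),
      ‖∫ t in (-π)..π, g (z * circleMap 0 1 t) * k t‖ ≤ (M1 + Mr) / 2 := by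
    intro z hz
    rw [frontier_ball _ one_ne_zero] at hz
    have hzc := sphere_subset_closedBall hz
    obtain ⟨s, rfl⟩ : ∃ s : ℝ, circleMap 0 1 s = z := by
      have := range_circleMap 0 1
      rw [abs_one] at this
      rw [← this] at hz; exact hz
    have hmul : ∀ t, circleMap 0 1 s * circleMap 0 1 t = circleMap 0 1 (t + s) := by
      intro t
      simp only [circleMap, ofReal_one, one_mul, zero_add, ← Complex.exp_add]
      congr 1; push_cast; ring
    have hrot : ∫ t in (-π)..π, ‖g (circleMap 0 1 s * circleMap 0 1 t)‖ ^ 2 = M1 := by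
      simp only [hmul]
      rw [intervalIntegral.integral_comp_add_right (fun t => ‖g (circleMap 0 1 t)‖ ^ 2)]
      have hp : Function.Periodic (fun t => ‖g (circleMap 0 1 t)‖ ^ 2) (2 * π) := by
        intro t; simp only; rw [periodic_circleMap 0 1 t]
      have := hp.intervalIntegral_add_eq (-π + s) (-π)
      have e1 : -π + s + 2 * π = π + s := by ring
      have e2 : -π + 2 * π = π := by ring
      rw [e1, e2] at this
      exact this
    have hint1 : IntervalIntegrable (fun t => ‖g (circleMap 0 1 s * circleMap 0 1 t)‖ ^ 2)
        volume (-π) π := ((hcz _ hzc).norm.pow 2).intervalIntegrable _ _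
    have hint2 : IntervalIntegrable (fun t => ‖g (r * circleMap 0 1 t)‖ ^ 2)
        volume (-π) π := ((hcz _ hrm).norm.pow 2).intervalIntegrable _ _
    calc _ ≤ ∫ t in (-π)..π, ‖g (circleMap 0 1 s * circleMap 0 1 t) * k t‖ :=
          intervalIntegral.norm_integral_le_integral_norm hππ
      _ ≤ ∫ t in (-π)..π, (‖g (circleMap 0 1 s * circleMap 0 1 t)‖ ^ 2
            + ‖g (r * circleMap 0 1 t)‖ ^ 2) / 2 := by
          apply intervalIntegral.integral_mono_on hππ
          · exact (((hcz _ hzc).mul hkc).norm).intervalIntegrable _ _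
          · exact (hint1.add hint2).div_const 2
          · intro t _
            rw [norm_mul, hk]
            simp only [RCLike.norm_conj]
            nlinarith [sq_nonneg (‖g (circleMap 0 1 s * circleMap 0 1 t)‖ - ‖g (r * circleMap 0 1 t)‖)]
      _ = (M1 + Mr) / 2 := by
          rw [intervalIntegral.integral_div, intervalIntegral.integral_add hint1 hint2, hrot]
  have hd : DiffContOnCl ℂ (fun z => ∫ t in (-π)..π, g (z * circleMap 0 1 t) * k t) (ball 0 1) := by
    refine ⟨kw_mean_hol hg hkc, ?_⟩
    rw [closure_ball _ one_ne_zero]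
    exact kw_mean_cont hgc hkc
  have hfin := Complex.norm_le_of_forall_mem_frontier_norm_le isBounded_ball hd hbd (z := (r : ℂ))
    (by rw [closure_ball _ one_ne_zero]; exact hrm)
  have hH : ∫ t in (-π)..π, g (r * circleMap 0 1 t) * k t = ((Mr : ℝ) : ℂ) := by
    rw [← intervalIntegral.integral_ofReal]
    congr 1; ext t
    rw [hk]; simp only [Complex.mul_conj, Complex.normSq_eq_norm_sq]
  rw [hH, Complex.norm_real] at hfin
  have := (le_abs_self Mr).trans hfin
  linarith

lemma kw_area {f f' : ℂ → ℂ} (hf : ∀ z ∈ ball (0 : ℂ) 1, HasDerivAt f (f' z) z)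
    (hc : ContinuousOn f' (closedBall 0 1)) (hinj : InjOn f (ball 0 1)) :
    (volume (f '' ball 0 1)).toReal ≤ (∫ z in sphere (0 : ℂ) 1, ‖f' z‖ ^ 2 ∂(μH[1])) / 2 := by
  have hf'd : DifferentiableOn ℂ f' (ball 0 1) := by
    have h1 : DifferentiableOn ℂ f (ball 0 1) :=
      fun z hz => (hf z hz).differentiableAt.differentiableWithinAt
    exact (h1.deriv isOpen_ball).congr (fun z hz => (hf z hz).deriv.symm)
  set M := ∫ t in (-π)..π, ‖f' (circleMap 0 1 t)‖ ^ 2 with hM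
  have hππ : -π ≤ π := by linarith [Real.pi_pos]
  have hM0 : 0 ≤ M := intervalIntegral.integral_nonneg hππ (fun t _ => by positivity)
  have e1 : ∫ z in sphere (0 : ℂ) 1, ‖f' z‖ ^ 2 ∂(μH[1]) = M := by
    rw [kw_hausdorff_integral (fun z => ‖f' z‖ ^ 2)
      ((hc.mono sphere_subset_closedBall).norm.pow 2),
      ← intervalIntegral.integral_of_le Real.two_pi_pos.le]
    have hp : Function.Periodic (fun t => ‖f' (circleMap 0 1 t)‖ ^ 2) (2 * π) := by
      intro t; simp only; rw [periodic_circleMap 0 1 t]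
    have := hp.intervalIntegral_add_eq 0 (-π)
    have e2 : -π + 2 * π = π := by ring
    rw [e2, zero_add] at this
    exact this
  rw [e1]
  have hvol : volume (f '' ball 0 1) = ∫⁻ z in ball (0 : ℂ) 1, ENNReal.ofReal (‖f' z‖ ^ 2) := by
    have := lintegral_image_eq_lintegral_abs_det_fderiv_mul (volume : Measure ℂ)
      (s := ball 0 1) (f := f) measurableSet_ball
      (fun z hz => ((hf z hz).hasFDerivAt.restrictScalars ℝ).hasFDerivWithinAt) hinj (fun _ => 1)
    rw [setLIntegral_one] at this
    rw [this]
    refine lintegral_congr fun z => ?_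
    rw [mul_one]
    congr 1
    simp [ContinuousLinearMap.det, LinearMap.det_restrictScalars,
      Algebra.norm_complex_eq, Complex.normSq_eq_norm_sq]
  have hb : volume (f '' ball 0 1) ≤ ENNReal.ofReal (M / 2) := by
    rw [hvol, ← lintegral_indicator measurableSet_ball, ← Complex.lintegral_comp_polarCoord_symm]
    have ht : polarCoord.target = Ioi (0 : ℝ) ×ˢ Ioo (-π) π := rfl
    rw [ht, Measure.volume_eq_prod, ← Measure.prod_restrict]
    refine (lintegral_prod_le _).trans ?_
    calc _ ≤ ∫⁻ r in Ioi (0 : ℝ), (Ioc (0 : ℝ) 1).indicator (fun r => ENNReal.ofReal (M * r)) r := by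
          refine setLIntegral_mono' measurableSet_Ioi fun r hr => ?_
          have hr0 : 0 < r := hr
          have hsym : ∀ t : ℝ, Complex.polarCoord.symm (r, t) = r * circleMap 0 1 t := by
            intro t
            rw [Complex.polarCoord_symm_apply]
            simp only [circleMap, ofReal_one, one_mul, zero_add, Complex.exp_mul_I]
            push_cast; rfl
          simp only [hsym]
          by_cases hr1 : r < 1
          · have hmem : ∀ t : ℝ, (r : ℂ) * circleMap 0 1 t ∈ ball (0 : ℂ) 1 := by
              intro t
              rw [mem_ball_zero_iff, norm_mul, kw_norm_circle, mul_one, Complex.norm_real,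
                Real.norm_of_nonneg hr0.le]
              exact hr1
            rw [indicator_of_mem (show r ∈ Ioc (0 : ℝ) 1 from ⟨hr0, hr1.le⟩)]
            simp only [indicator_of_mem (hmem _), smul_eq_mul]
            have hcont : Continuous fun t : ℝ => ‖f' ((r : ℂ) * circleMap 0 1 t)‖ ^ 2 :=
              (hf'd.continuousOn.comp_continuous (continuous_const.mul (continuous_circleMap 0 1))
                hmem).norm.pow 2
            rw [lintegral_const_mul _ (by exact hcont.measurable.ennreal_ofReal),
              ← ofReal_integral_eq_lintegral_ofReal
                (hcont.integrableOn_Icc.mono_set Ioo_subset_Icc_self)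
                (Eventually.of_forall fun t => by positivity), ← ENNReal.ofReal_mul hr0.le]
            apply ENNReal.ofReal_le_ofReal
            rw [mul_comm]
            gcongr
            rw [← integral_Ioc_eq_integral_Ioo, ← intervalIntegral.integral_of_le hππ]
            exact kw_mean hf'd hc hr0.le hr1.le
          · have hmem : ∀ t : ℝ, (r : ℂ) * circleMap 0 1 t ∉ ball (0 : ℂ) 1 := by
              intro t
              rw [mem_ball_zero_iff, norm_mul, kw_norm_circle, mul_one, Complex.norm_real,
                Real.norm_of_nonneg hr0.le]
              exact hr1
            simp only [indicator_of_notMem (hmem _), smul_zero, lintegral_zero, zero_le]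
      _ = ∫⁻ r in Ioc (0 : ℝ) 1, ENNReal.ofReal (M * r) := by
          rw [setLIntegral_indicator measurableSet_Ioc,
            inter_eq_left.2 (fun x hx => hx.1)]
      _ = ENNReal.ofReal (M / 2) := by
          rw [← ofReal_integral_eq_lintegral_ofReal]
          · rw [← intervalIntegral.integral_of_le zero_le_one, intervalIntegral.integral_const_mul,
              integral_id]
            congr 1; ring
          · exact (by fun_prop : Continuous fun r : ℝ => M * r).integrableOn_Icc.mono_set Ioc_subset_Icc_self
          · refine (ae_restrict_mem measurableSet_Ioc).mono fun r hr => ?_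
            exact mul_nonneg hM0 hr.1.le
  have := ENNReal.toReal_mono ENNReal.ofReal_ne_top hb
  rwa [ENNReal.toReal_ofReal (by positivity)] at this


lemma kw_ne {w : ℂ} (hw : ‖w‖ < 1) (t : ℝ) : circleMap 0 1 t - w ≠ 0 := by
  intro h
  have := kw_norm_circle t
  rw [sub_eq_zero.1 h] at this
  linarith

lemma kw_cauchy_deriv {u : ℝ → ℂ} (hu : Continuous u) (n : ℕ) {w₀ : ℂ} (hw₀ : ‖w₀‖ < 1) :
    HasDerivAt (fun w => ∫ t in (-π)..π, u t * ((circleMap 0 1 t - w) ^ n)⁻¹)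
      (∫ t in (-π)..π, u t * (n * ((circleMap 0 1 t - w₀) ^ (n + 1))⁻¹)) w₀ := by
  set ρ := (1 - ‖w₀‖) / 2 with hρ
  have hρ0 : 0 < ρ := by rw [hρ]; linarith
  have hw1 : ∀ w ∈ ball w₀ ρ, ‖w‖ ≤ 1 - ρ := by
    intro w hw
    have h1 : ‖w - w₀‖ < ρ := by simpa [dist_eq_norm] using hw
    have h2 := norm_sub_norm_le w w₀
    linarith
  have hw2 : ∀ w ∈ ball w₀ ρ, ‖w‖ < 1 := fun w hw => by linarith [hw1 w hw]
  have hc : ∀ w ∈ ball w₀ ρ, ∀ m : ℕ, Continuous fun t => ((circleMap 0 1 t - w) ^ m)⁻¹ :=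
    fun w hw m => (((continuous_circleMap 0 1).sub continuous_const).pow m).inv₀
      (fun t => pow_ne_zero _ (kw_ne (hw2 w hw) t))
  have hlow : ∀ w ∈ ball w₀ ρ, ∀ t, ρ ≤ ‖circleMap 0 1 t - w‖ := by
    intro w hw t
    have := norm_sub_norm_le (circleMap 0 1 t) w
    rw [kw_norm_circle] at this
    linarith [hw1 w hw]
  have key := intervalIntegral.hasDerivAt_integral_of_dominated_loc_of_deriv_le (𝕜 := ℂ)
    (μ := volume) (a := -π) (b := π) (x₀ := w₀) (s := ball w₀ ρ)
    (F := fun w t => u t * ((circleMap 0 1 t - w) ^ n)⁻¹)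
    (F' := fun w t => u t * (n * ((circleMap 0 1 t - w) ^ (n + 1))⁻¹))
    (bound := fun t => ‖u t‖ * (n * (ρ ^ (n + 1))⁻¹)) (ball_mem_nhds _ hρ0)
    (by
      filter_upwards [ball_mem_nhds w₀ hρ0] with w hw
      exact (hu.mul (hc w hw n)).aestronglyMeasurable)
    ((hu.mul (hc w₀ (mem_ball_self hρ0) n)).intervalIntegrable _ _)
    ((hu.mul (continuous_const.mul (hc w₀ (mem_ball_self hρ0) (n + 1)))).aestronglyMeasurable)
    (by
      refine Eventually.of_forall fun t _ w hw => ?_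
      rw [norm_mul, norm_mul, norm_inv, norm_pow, Complex.norm_natCast]
      gcongr
      exact hlow w hw t)
    ((hu.norm.mul continuous_const).intervalIntegrable _ _)
    (by
      refine Eventually.of_forall fun t _ w hw => ?_
      have hne := kw_ne (hw2 w hw) t
      have h1 : HasDerivAt (fun w : ℂ => circleMap 0 1 t - w) (-1) w :=
        (hasDerivAt_id w).const_sub _
      have h2 := ((h1.pow n).inv (pow_ne_zero n hne)).const_mul (u t)
      have e : u t * (n * ((circleMap 0 1 t - w) ^ (n + 1))⁻¹)
        = u t * (-(↑n * (circleMap 0 1 t - w) ^ (n - 1) * -1) / ((circleMap 0 1 t - w) ^ n) ^ 2) := by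
        congr 1
        rcases n with _ | n
        · simp
        · simp only [Nat.add_sub_cancel]
          field_simp
          ring
      rw [e]; exact h2)
  exact key.2

lemma kw_circle_shift {G : ℂ → ℂ} : ∫ t in (0)..(2 * π), G (circleMap 0 1 t)
    = ∫ t in (-π)..π, G (circleMap 0 1 t) := by
  have hp : Function.Periodic (fun t => G (circleMap 0 1 t)) (2 * π) := by
    intro t; simp only; rw [periodic_circleMap 0 1 t]
  have := hp.intervalIntegral_add_eq 0 (-π)
  have e2 : -π + 2 * π = π := by ring
  rw [e2, zero_add] at this
  exact this

lemma kw_cauchy {F : ℂ → ℂ} (hF : DiffContOnCl ℂ F (ball 0 1)) {w : ℂ} (hw : ‖w‖ < 1) :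
    ∫ t in (-π)..π, F (circleMap 0 1 t) * circleMap 0 1 t * (circleMap 0 1 t - w)⁻¹
      = 2 * π * F w := by
  have h := hF.circleIntegral_sub_inv_smul (w := w) (by simpa using hw)
  rw [circleIntegral] at h
  rw [← kw_circle_shift (G := fun z => F z * z * (z - w)⁻¹)]
  have h2 : ∫ t in (0)..(2 * π), deriv (circleMap 0 1) t • (circleMap 0 1 t - w)⁻¹ • F (circleMap 0 1 t)
    = I * ∫ t in (0)..(2 * π), F (circleMap 0 1 t) * circleMap 0 1 t * (circleMap 0 1 t - w)⁻¹ := by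
    rw [← intervalIntegral.integral_const_mul]
    congr 1; ext t
    simp only [deriv_circleMap, smul_eq_mul]; ring
  rw [h2, smul_eq_mul] at h
  have hI := Complex.I_ne_zero
  apply mul_left_cancel₀ hI
  rw [h]; ring

lemma kw_schwarz {F : ℂ → ℂ} (hF : DiffContOnCl ℂ F (ball 0 1)) {w : ℂ} (hw : ‖w‖ < 1) :
    F w = (π : ℂ)⁻¹ * (∫ t in (-π)..π, (((F (circleMap 0 1 t)).re : ℂ) * circleMap 0 1 t)
      * ((circleMap 0 1 t - w) ^ 1)⁻¹) - (starRingEnd ℂ) (F 0) := by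
  have hFc : Continuous fun t => F (circleMap 0 1 t) := by
    have := hF.continuousOn
    rw [closure_ball _ one_ne_zero] at this
    exact this.comp_continuous (continuous_circleMap 0 1) (fun t => by
      rw [mem_closedBall_zero_iff, kw_norm_circle])
  have h1 := kw_cauchy hF hw
  -- the conjugate part
  have hden : ∀ z ∈ closure (ball (0 : ℂ) 1), 1 - (starRingEnd ℂ) w * z ≠ 0 := by
    intro z hz h
    rw [closure_ball _ one_ne_zero, mem_closedBall_zero_iff] at hz
    have h3 : ‖(starRingEnd ℂ) w * z‖ = 1 := by rw [← sub_eq_zero.1 h, norm_one]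
    rw [norm_mul, RCLike.norm_conj] at h3
    nlinarith [norm_nonneg z, norm_nonneg w]
  have hG : DiffContOnCl ℂ (fun z => (1 - (starRingEnd ℂ) w * z)⁻¹ * F z) (ball 0 1) := by
    have hd : DiffContOnCl ℂ (fun z : ℂ => 1 - (starRingEnd ℂ) w * z) (ball 0 1) :=
      (by fun_prop : Differentiable ℂ fun z : ℂ => 1 - (starRingEnd ℂ) w * z).diffContOnCl
    have := (hd.inv hden).smul hF
    exact this
  have h2 := kw_cauchy hG (w := 0) (by simp)
  have h3 : ∫ t in (-π)..π, (starRingEnd ℂ) (F (circleMap 0 1 t)) * circleMap 0 1 t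
      * (circleMap 0 1 t - w)⁻¹ = 2 * π * (starRingEnd ℂ) (F 0) := by
    have h4 := congrArg (starRingEnd ℂ) h2
    rw [intervalIntegral.integral_of_le (by linarith [Real.pi_pos]), ← integral_conj,
      ← intervalIntegral.integral_of_le (by linarith [Real.pi_pos])] at h4
    have e : 2 * π * (starRingEnd ℂ) (F 0)
      = (starRingEnd ℂ) (2 * π * ((1 - (starRingEnd ℂ) w * 0)⁻¹ * F 0)) := by
      simp only [map_mul, mul_zero, sub_zero, inv_one, one_mul, map_ofNat, Complex.conj_ofReal]
    rw [e, ← h4]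
    congr 1; ext t
    have hc : (starRingEnd ℂ) (circleMap 0 1 t) * circleMap 0 1 t = 1 := by
      rw [mul_comm, Complex.mul_conj, Complex.normSq_eq_norm_sq, kw_norm_circle]; simp
    have hne : circleMap 0 1 t ≠ 0 := by
      intro h; have := kw_norm_circle t; rw [h] at this; simp at this
    have hne2 : (starRingEnd ℂ) (circleMap 0 1 t) ≠ 0 := by
      intro h; rw [h] at hc; simp at hc
    have hne3 := kw_ne hw t
    simp only [map_mul, map_inv₀, map_sub, map_one, Complex.conj_conj, sub_zero]
    have e3 : (circleMap 0 1 t - w)⁻¹ * circleMap 0 1 t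
        = (1 - w * (starRingEnd ℂ) (circleMap 0 1 t))⁻¹ := by
      have : 1 - w * (starRingEnd ℂ) (circleMap 0 1 t)
        = (circleMap 0 1 t - w) * (starRingEnd ℂ) (circleMap 0 1 t) := by
        rw [← hc]; ring
      rw [this, mul_inv]
      congr 1
      exact eq_inv_of_mul_eq_one_right hc
    rw [mul_assoc, mul_comm (circleMap 0 1 t), e3, mul_assoc, mul_assoc, mul_inv_cancel₀ hne2]
    ring
  have hci : Continuous fun t => (circleMap 0 1 t - w)⁻¹ :=
    ((continuous_circleMap 0 1).sub continuous_const).inv₀ (fun t => kw_ne hw t)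
  have h5 : ∫ t in (-π)..π, (((F (circleMap 0 1 t)).re : ℂ) * circleMap 0 1 t)
      * ((circleMap 0 1 t - w) ^ 1)⁻¹ = π * F w + π * (starRingEnd ℂ) (F 0) := by
    have h6 : ∀ t : ℝ, (((F (circleMap 0 1 t)).re : ℂ) * circleMap 0 1 t)
      * ((circleMap 0 1 t - w) ^ 1)⁻¹ = (F (circleMap 0 1 t) * circleMap 0 1 t
        * (circleMap 0 1 t - w)⁻¹ + (starRingEnd ℂ) (F (circleMap 0 1 t)) * circleMap 0 1 t
      * (circleMap 0 1 t - w)⁻¹) / 2 := by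
      intro t
      rw [Complex.re_eq_add_conj, pow_one]; ring
    simp only [h6]
    rw [intervalIntegral.integral_div, intervalIntegral.integral_add, h1, h3]
    · ring
    · exact ((hFc.mul (continuous_circleMap 0 1)).mul hci).intervalIntegrable _ _
    · exact (((Complex.continuous_conj.comp hFc).mul (continuous_circleMap 0 1)).mul hci).intervalIntegrable _ _
  rw [h5]
  have : (π : ℂ) ≠ 0 := by exact_mod_cast Real.pi_ne_zero
  field_simp
  ring

lemma kw_second {F : ℂ → ℂ} (hF : DiffContOnCl ℂ F (ball 0 1)) {w : ℂ} (hw : ‖w‖ < 1) :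
    deriv (deriv F) w = (π : ℂ)⁻¹ * (∫ t in (-π)..π, (((F (circleMap 0 1 t)).re : ℂ) * circleMap 0 1 t)
      * (2 * ((circleMap 0 1 t - w) ^ 3)⁻¹)) := by
  have hFc : Continuous fun t => F (circleMap 0 1 t) := by
    have := hF.continuousOn
    rw [closure_ball _ one_ne_zero] at this
    exact this.comp_continuous (continuous_circleMap 0 1) (fun t => by
      rw [mem_closedBall_zero_iff, kw_norm_circle])
  have hu : Continuous fun t => (((F (circleMap 0 1 t)).re : ℂ) * circleMap 0 1 t) :=
    (Complex.continuous_ofReal.comp (Complex.continuous_re.comp hFc)).mul (continuous_circleMap 0 1)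
  have h1 : ∀ v ∈ ball (0 : ℂ) 1, deriv F v = (π : ℂ)⁻¹ * (∫ t in (-π)..π,
      (((F (circleMap 0 1 t)).re : ℂ) * circleMap 0 1 t) * ((circleMap 0 1 t - v) ^ 2)⁻¹) := by
    intro v hv
    have hv1 : ‖v‖ < 1 := by simpa using hv
    have hd := ((kw_cauchy_deriv hu 1 hv1).const_mul ((π : ℂ)⁻¹)).sub_const ((starRingEnd ℂ) (F 0))
    have he : F =ᶠ[𝓝 v] fun w => (π : ℂ)⁻¹ * (∫ t in (-π)..π, (((F (circleMap 0 1 t)).re : ℂ) * circleMap 0 1 t)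
      * ((circleMap 0 1 t - w) ^ 1)⁻¹) - (starRingEnd ℂ) (F 0) := by
      filter_upwards [isOpen_ball.mem_nhds hv] with z hz
      exact kw_schwarz hF (by simpa using hz)
    rw [he.deriv_eq, hd.deriv]
    simp
  have he : deriv F =ᶠ[𝓝 w] fun v => (π : ℂ)⁻¹ * (∫ t in (-π)..π,
      (((F (circleMap 0 1 t)).re : ℂ) * circleMap 0 1 t) * ((circleMap 0 1 t - v) ^ 2)⁻¹) := by
    filter_upwards [isOpen_ball.mem_nhds (by simpa using hw : w ∈ ball (0 : ℂ) 1)] with z hz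
    exact h1 z hz
  rw [he.deriv_eq, ((kw_cauchy_deriv hu 2 hw).const_mul ((π : ℂ)⁻¹)).deriv]
  simp

lemma kw_int_bound {β δ : ℝ} (hβ1 : β < 1) (hδ : 0 < δ) :
    ∫ t in (-π)..π, (δ + |t|) ^ (β - 2) ≤ 2 / (1 - β) * δ ^ (β - 1) := by
  have hc : Continuous fun t : ℝ => (δ + |t|) ^ (β - 2) :=
    (continuous_const.add continuous_abs).rpow_const
      (fun t => Or.inl (by
        have := abs_nonneg t
        show δ + |t| ≠ 0
        positivity))
  have h0 : ∫ t in (0)..π, (δ + |t|) ^ (β - 2) ≤ 1 / (1 - β) * δ ^ (β - 1) := by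
    have e1 : ∫ t in (0)..π, (δ + |t|) ^ (β - 2) = ∫ t in (0)..π, (δ + t) ^ (β - 2) := by
      apply intervalIntegral.integral_congr
      intro t ht
      rw [uIcc_of_le Real.pi_pos.le] at ht
      simp only [abs_of_nonneg ht.1]
    rw [e1, intervalIntegral.integral_comp_add_left (fun t => t ^ (β - 2)) δ, integral_rpow]
    · have h2 : 0 ≤ (δ + π) ^ (β - 1) := by have := Real.pi_pos; positivity
      have e2 : β - 2 + 1 = β - 1 := by ring
      rw [e2, add_zero]
      have e3 : ((δ + π) ^ (β - 1) - δ ^ (β - 1)) / (β - 1)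
        = 1 / (1 - β) * δ ^ (β - 1) - 1 / (1 - β) * (δ + π) ^ (β - 1) := by
        have h3 : 1 - β ≠ 0 := by linarith
        have h4 : β - 1 ≠ 0 := by linarith
        field_simp
        ring
      rw [e3]
      have : 0 ≤ 1 / (1 - β) * (δ + π) ^ (β - 1) :=
        mul_nonneg (one_div_nonneg.2 (by linarith)) h2
      linarith
    · right
      refine ⟨by linarith, ?_⟩
      rw [uIcc_of_le (by linarith [Real.pi_pos])]
      intro h; have := h.1; linarith
  have h1 : ∫ t in (-π)..0, (δ + |t|) ^ (β - 2) = ∫ t in (0)..π, (δ + |t|) ^ (β - 2) := by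
    have := intervalIntegral.integral_comp_neg (a := 0) (b := π) (fun t : ℝ => (δ + |t|) ^ (β - 2))
    simp only [abs_neg, neg_zero] at this
    exact this.symm
  rw [← intervalIntegral.integral_add_adjacent_intervals (hc.intervalIntegrable (-π) 0)
    (hc.intervalIntegrable 0 π), h1]
  have e : 2 / (1 - β) * δ ^ (β - 1) = 1 / (1 - β) * δ ^ (β - 1) + 1 / (1 - β) * δ ^ (β - 1) := by ring
  rw [e]; linarith

lemma kw_core (β : ℝ) (hβ : 0 < β) (hβ1 : β < 1) : ∃ C : ℝ, 0 ≤ C ∧ ∀ (F : ℂ → ℂ) (M : ℝ), 0 ≤ M →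
    DiffContOnCl ℂ F (ball 0 1) →
    (∀ t : ℝ, |(F (circleMap 0 1 t)).re| ≤ M * ‖circleMap 0 1 t - 1‖ ^ (1 + β)) →
    ∀ r : ℝ, 0 ≤ r → r < 1 → ‖deriv (deriv F) (r : ℂ)‖ ≤ C * M * (1 - r) ^ (β - 1) := by
  have hπ := Real.pi_pos
  refine ⟨π⁻¹ * (2 * 2 ^ (1 + β) * (1 + π) ^ (2 - β)) * (2 / (1 - β)), ?_, ?_⟩
  · have : 0 ≤ 2 / (1 - β) := div_nonneg two_pos.le (by linarith)
    positivity
  intro F M hM hF hb r hr0 hr1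
  have hrn : ‖(r : ℂ)‖ < 1 := by rw [Complex.norm_real, Real.norm_of_nonneg hr0]; exact hr1
  rw [kw_second hF hrn, norm_mul, norm_inv, Complex.norm_real, Real.norm_of_nonneg hπ.le]
  have hpt : ∀ t ∈ Icc (-π) π, ‖(((F (circleMap 0 1 t)).re : ℂ) * circleMap 0 1 t)
      * (2 * ((circleMap 0 1 t - r) ^ 3)⁻¹)‖
      ≤ (2 * 2 ^ (1 + β) * (1 + π) ^ (2 - β)) * M * (1 - r + |t|) ^ (β - 2) := by
    intro t ht
    rw [norm_mul, norm_mul, norm_mul, norm_inv, norm_pow, kw_norm_circle, Complex.norm_real,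
      Real.norm_eq_abs, mul_one, Complex.norm_two]
    set d := ‖circleMap 0 1 t - r‖ with hd
    have hd1 : 1 - r ≤ d := by
      have := norm_sub_norm_le (circleMap 0 1 t) (r : ℂ)
      rw [kw_norm_circle, Complex.norm_real, Real.norm_of_nonneg hr0] at this
      exact this
    have hd0 : 0 < d := by linarith
    have hd2 : ‖circleMap 0 1 t - 1‖ ≤ 2 * d := by
      have h1 : circleMap 0 1 t - 1 = (circleMap 0 1 t - r) - ((1 - r : ℝ) : ℂ) := by push_cast; ring
      rw [h1]
      refine (norm_sub_le _ _).trans ?_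
      rw [Complex.norm_real, Real.norm_of_nonneg (by linarith)]
      linarith
    have hd3 : 1 - r + |t| ≤ (1 + π) * d := by
      have h1 : ‖circleMap 0 1 t - 1‖ = ‖2 * Real.sin (t / 2)‖ := by
        rw [← Complex.norm_exp_I_mul_ofReal_sub_one]
        simp [circleMap, mul_comm]
      have h2 := Real.mul_abs_le_abs_sin (x := t / 2) (by
        rw [abs_div, abs_two]
        have := abs_le.2 ⟨ht.1, ht.2⟩; linarith)
      rw [h1, norm_mul, Real.norm_eq_abs, Real.norm_eq_abs, abs_two] at hd2
      rw [abs_div, abs_two] at h2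
      have h3 : |t| / π ≤ d := by
        calc |t| / π = 2 / π * (|t| / 2) := by field_simp
          _ ≤ _ := h2
          _ ≤ d := by linarith
      rw [div_le_iff₀ hπ] at h3
      linarith
    have hs : 0 < 1 - r + |t| := by linarith [abs_nonneg t]
    calc |(F (circleMap 0 1 t)).re| * (2 * (d ^ 3)⁻¹)
        ≤ (M * (2 * d) ^ (1 + β)) * (2 * (d ^ 3)⁻¹) := by
          gcongr
          refine (hb t).trans ?_
          gcongr
      _ = 2 * 2 ^ (1 + β) * M * d ^ (β - 2) := by
          rw [Real.mul_rpow two_pos.le hd0.le]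
          have : d ^ (β - 2) = d ^ (1 + β) * (d ^ 3)⁻¹ := by
            rw [← Real.rpow_natCast, ← Real.rpow_neg hd0.le, ← Real.rpow_add hd0]
            congr 1; push_cast; ring
          rw [this]; ring
      _ ≤ 2 * 2 ^ (1 + β) * M * ((1 + π) ^ (2 - β) * (1 - r + |t|) ^ (β - 2)) := by
          gcongr
          have h1 : (1 - r + |t|) / (1 + π) ≤ d := by
            rw [div_le_iff₀ (by positivity)]; linarith
          have h2 : d ^ (β - 2) ≤ ((1 - r + |t|) / (1 + π)) ^ (β - 2) :=
            Real.rpow_le_rpow_of_nonpos (by positivity) h1 (by linarith)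
          refine h2.trans (le_of_eq ?_)
          rw [Real.div_rpow hs.le (by positivity), div_eq_mul_inv, ← Real.rpow_neg (by positivity), mul_comm]
          congr 2; ring
      _ = _ := by ring
  have hci : Continuous fun t : ℝ => (2 * 2 ^ (1 + β) * (1 + π) ^ (2 - β)) * M * (1 - r + |t|) ^ (β - 2) :=
    continuous_const.mul ((continuous_const.add continuous_abs).rpow_const
      (fun t => Or.inl (by
        have := abs_nonneg t
        show 1 - r + |t| ≠ 0
        intro h
        linarith)))
  have h1 := intervalIntegral.norm_integral_le_of_norm_le (μ := volume) (by linarith : -π ≤ π)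
    (Eventually.of_forall fun t ht => hpt t (Ioc_subset_Icc_self ht)) (hci.intervalIntegrable (-π) π)
  rw [intervalIntegral.integral_const_mul] at h1
  have h2 := kw_int_bound hβ1 (by linarith : 0 < 1 - r)
  calc _ ≤ π⁻¹ * ((2 * 2 ^ (1 + β) * (1 + π) ^ (2 - β)) * M * (2 / (1 - β) * (1 - r) ^ (β - 1))) := by
        gcongr
        exact h1.trans (by gcongr)
    _ = _ := by ring




lemma kw_graph {Ω U : Set ℂ} {e : ℂ} {g : ℝ → ℝ} (hΩ : IsOpen Ω) (hU : IsOpen U)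
    (hg : Continuous g) (h : Ω ∩ U = {w ∈ U | g ((e * w).re) < (e * w).im})
    {w : ℂ} (hw : w ∈ U) (hf : w ∈ frontier Ω) : (e * w).im = g ((e * w).re) := by
  rw [hΩ.frontier_eq] at hf
  have hc : Continuous fun w : ℂ => g ((e * w).re) - (e * w).im := by fun_prop
  apply le_antisymm
  · by_contra! hlt
    exact hf.2 (h.symm.subset ⟨hw, hlt⟩ : w ∈ Ω ∩ U).1
  · by_contra! hlt
    have hev : ∀ᶠ v in 𝓝 w, v ∈ U ∧ 0 < g ((e * v).re) - (e * v).im :=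
      (hU.eventually_mem hw).and (hc.continuousAt.eventually (lt_mem_nhds (by linarith)))
    obtain ⟨v, hv1, hv2⟩ := mem_closure_iff_nhds.1 hf.1 _ hev
    have : v ∈ Ω ∩ U := ⟨hv2, hv1.1⟩
    rw [h] at this
    have := this.2
    linarith [hv1.2]

/-- the unit normal determined by slope `m` -/
def kwNormal (e : ℂ) (m : ℝ) : ℂ :=
  (starRingEnd ℂ) e * (-m + I) / (Real.sqrt (1 + m ^ 2) : ℝ)

lemma kwNormal_norm {e : ℂ} (he : ‖e‖ = 1) (m : ℝ) : ‖kwNormal e m‖ = 1 := by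
  have hs : 0 < 1 + m ^ 2 := by positivity
  have h1 : ‖(-m + I : ℂ)‖ = Real.sqrt (1 + m ^ 2) := by
    rw [Complex.norm_eq_sqrt_sq_add_sq]
    congr 1; simp; ring
  rw [kwNormal, norm_div, norm_mul, RCLike.norm_conj, he, h1, Complex.norm_real,
    Real.norm_of_nonneg (Real.sqrt_nonneg _), one_mul, div_self (Real.sqrt_pos.2 hs).ne']

lemma kwNormal_re (e v : ℂ) (m : ℝ) :
    (v * (starRingEnd ℂ) (kwNormal e m)).re * Real.sqrt (1 + m ^ 2) = (e * v).im - m * (e * v).re := by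
  have hs : Real.sqrt (1 + m ^ 2) ≠ 0 := (Real.sqrt_pos.2 (by positivity)).ne'
  have h1 : v * (starRingEnd ℂ) (kwNormal e m)
      = ((Real.sqrt (1 + m ^ 2))⁻¹ : ℝ) * ((e * v) * (-m - I)) := by
    simp only [kwNormal, map_div₀, map_mul, Complex.conj_conj, Complex.conj_ofReal, map_add, map_neg,
      Complex.conj_I]
    push_cast
    field_simp
    ring
  rw [h1, Complex.re_ofReal_mul]
  have h2 : ((e * v) * (-m - I)).re = (e * v).im - m * (e * v).re := by
    rw [Complex.mul_re]; simp; ring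
  rw [h2]; field_simp

lemma kw_cone {Ω : Set ℂ} {α : ℝ≥0} (hΩ : IsOpen Ω) (hb : HasC1AlphaBoundary α Ω)
    {p₀ : ℂ} (hp₀ : p₀ ∈ frontier Ω) {η : ℝ} (hη : 0 < η) :
    ∃ r > 0, ∃ ν : ℂ, ‖ν‖ = 1 ∧ ∀ p ∈ frontier Ω, p ∈ ball p₀ r → ∀ w ∈ ball p₀ r,
      (η * ‖w - p‖ < ((w - p) * (starRingEnd ℂ) ν).re → w ∈ Ω) ∧
      (((w - p) * (starRingEnd ℂ) ν).re < -(η * ‖w - p‖) → w ∉ Ω) := by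
  obtain ⟨U, e, g, C, hU, hpU, he, hg, -, hchart⟩ := hb p₀ hp₀
  set m := deriv g ((e * p₀).re) with hm
  have hst : HasStrictDerivAt g m ((e * p₀).re) :=
    (hg.contDiffAt).hasStrictDerivAt one_ne_zero
  have hlo := hst.isLittleO.def hη
  rw [nhds_prod_eq, Metric.nhds_basis_ball.prod_self.eventually_iff] at hlo
  obtain ⟨δ, hδ, hlo⟩ := hlo
  obtain ⟨r₁, hr₁, hball⟩ := Metric.isOpen_iff.1 hU p₀ hpU
  have hre : ∀ w ∈ ball p₀ (min r₁ δ), (e * w).re ∈ ball ((e * p₀).re) δ := by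
    intro w hw
    rw [mem_ball, Real.dist_eq, ← Complex.sub_re, ← mul_sub]
    refine (Complex.abs_re_le_norm _).trans_lt ?_
    rw [norm_mul, he, one_mul, ← dist_eq_norm]
    exact (mem_ball.1 hw).trans_le (min_le_right _ _)
  refine ⟨min r₁ δ, lt_min hr₁ hδ, kwNormal e m, kwNormal_norm he m, ?_⟩
  intro p hp hpb w hw
  have hpU' : p ∈ U := hball (ball_subset_ball (min_le_left _ _) hpb)
  have hwU : w ∈ U := hball (ball_subset_ball (min_le_left _ _) hw)
  have hgp := kw_graph hΩ hU hg.continuous hchart hpU' hp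
  have h1 := hlo (x := ((e * w).re, (e * p).re)) ⟨hre w hw, hre p hpb⟩
  simp only [Real.norm_eq_abs] at h1
  have h2 := kwNormal_re e (w - p) m
  set s := Real.sqrt (1 + m ^ 2) with hs
  have hs1 : 1 ≤ s := by
    rw [hs]; apply Real.one_le_sqrt.2; nlinarith
  set k := ((w - p) * (starRingEnd ℂ) (kwNormal e m)).re
  have h3 : |(e * w).re - (e * p).re| ≤ ‖w - p‖ := by
    rw [← Complex.sub_re, ← mul_sub]
    refine (Complex.abs_re_le_norm _).trans ?_
    rw [norm_mul, he, one_mul]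
  rw [mul_sub, Complex.sub_im, Complex.sub_re] at h2
  have h4 : η * |(e * w).re - (e * p).re| ≤ η * ‖w - p‖ := by gcongr
  have h5 := abs_le.1 h1
  simp only [smul_eq_mul, ContinuousLinearMap.toSpanSingleton_apply] at h5
  have hn := norm_nonneg (w - p)
  have hηn : 0 ≤ η * ‖w - p‖ := by positivity
  constructor
  · intro hk
    have h6 : k ≤ k * s := by nlinarith
    have : w ∈ Ω ∩ U := by
      rw [hchart]; refine ⟨hwU, ?_⟩
      nlinarith
    exact this.1
  · intro hk hwΩ
    have h6 : k * s ≤ k := by nlinarith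
    have : w ∈ Ω ∩ U := ⟨hwΩ, hwU⟩
    rw [hchart] at this
    have := this.2
    nlinarith

lemma kw_taylor {g : ℝ → ℝ} {C α : ℝ≥0} (hg : ContDiff ℝ 1 g) (hh : HolderWith C α (deriv g))
    (x y : ℝ) : |g x - g y - deriv g y * (x - y)| ≤ C * |x - y| ^ (1 + (α : ℝ)) := by
  have hd : Differentiable ℝ g := hg.differentiable one_ne_zero
  have hconv : Convex ℝ (uIcc y x) := convex_uIcc y x
  have key := hconv.norm_image_sub_le_of_norm_hasDerivWithin_le (f := fun t => g t - deriv g y * t)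
    (f' := fun t => deriv g t - deriv g y) (C := C * |x - y| ^ (α : ℝ)) (x := y) (y := x)
    (fun t _ => by
      have h1 := ((hd t).hasDerivAt.sub ((hasDerivAt_id t).const_mul (deriv g y)))
      rw [mul_one] at h1
      exact h1.hasDerivWithinAt)
    (fun t ht => by
      have h1 := hh.dist_le t y
      rw [Real.dist_eq, Real.dist_eq] at h1
      rw [Real.norm_eq_abs]
      refine h1.trans ?_
      have h2 : |t - y| ≤ |x - y| := abs_sub_left_of_mem_uIcc ht
      exact mul_le_mul_of_nonneg_left (Real.rpow_le_rpow (abs_nonneg _) h2 α.coe_nonneg)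
        C.coe_nonneg)
    left_mem_uIcc right_mem_uIcc
  rw [Real.norm_eq_abs, Real.norm_eq_abs] at key
  have e1 : g x - deriv g y * x - (g y - deriv g y * y) = g x - g y - deriv g y * (x - y) := by ring
  rw [e1] at key
  refine key.trans (le_of_eq ?_)
  rcases eq_or_ne x y with rfl | hne
  · simp; right; rw [Real.zero_rpow]; positivity
  · have : 0 < |x - y| := abs_pos.2 (sub_ne_zero.2 hne)
    rw [Real.rpow_add this, Real.rpow_one]; ring

lemma kw_flat {Ω : Set ℂ} {α : ℝ≥0} (hα : 0 < α) (hΩ : IsOpen Ω) (hbd : Bornology.IsBounded Ω)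
    (hb : HasC1AlphaBoundary α Ω) :
    ∃ C : ℝ, 0 ≤ C ∧ ∀ p ∈ frontier Ω, ∃ ν : ℂ, ‖ν‖ = 1 ∧ ∀ w ∈ frontier Ω,
      |((w - p) * (starRingEnd ℂ) ν).re| ≤ C * ‖w - p‖ ^ (1 + (α : ℝ)) := by
  have hcomp : IsCompact (frontier Ω) :=
    (hbd.closure.isCompact_closure.of_isClosed_subset isClosed_frontier
      (frontier_subset_closure.trans subset_closure))
  have hα' : 0 < (α : ℝ) := by exact_mod_cast hα
  suffices H : ∃ C : ℝ, 0 ≤ C ∧ ∀ p ∈ frontier Ω, p ∈ frontier Ω → ∃ ν : ℂ, ‖ν‖ = 1 ∧ ∀ w ∈ frontier Ω,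
      |((w - p) * (starRingEnd ℂ) ν).re| ≤ C * ‖w - p‖ ^ (1 + (α : ℝ)) by
    obtain ⟨C, h0, h⟩ := H
    exact ⟨C, h0, fun p hp => h p hp hp⟩
  refine hcomp.induction_on (p := fun S => ∃ C : ℝ, 0 ≤ C ∧ ∀ p ∈ S, p ∈ frontier Ω →
    ∃ ν : ℂ, ‖ν‖ = 1 ∧ ∀ w ∈ frontier Ω,
      |((w - p) * (starRingEnd ℂ) ν).re| ≤ C * ‖w - p‖ ^ (1 + (α : ℝ))) ?_ ?_ ?_ ?_
  · exact ⟨0, le_rfl, fun p hp => absurd hp (notMem_empty p)⟩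
  · rintro S T hST ⟨C, hC, h⟩
    exact ⟨C, hC, fun p hp => h p (hST hp)⟩
  · rintro S T ⟨C, hC, h⟩ ⟨D, hD, h'⟩
    refine ⟨C + D, add_nonneg hC hD, fun p hp hpf => ?_⟩
    rcases hp with hp | hp
    · obtain ⟨ν, hν, hh⟩ := h p hp hpf
      refine ⟨ν, hν, fun w hw => (hh w hw).trans ?_⟩
      gcongr; linarith
    · obtain ⟨ν, hν, hh⟩ := h' p hp hpf
      refine ⟨ν, hν, fun w hw => (hh w hw).trans ?_⟩
      gcongr; linarith
  · intro p₀ hp₀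
    obtain ⟨U, e, g, C, hU, hpU, he, hg, hh, hchart⟩ := hb p₀ hp₀
    obtain ⟨r₁, hr₁, hball⟩ := Metric.isOpen_iff.1 hU p₀ hpU
    set r := r₁ / 2 with hr
    have hr0 : 0 < r := by positivity
    refine ⟨ball p₀ r, mem_nhdsWithin_of_mem_nhds (ball_mem_nhds _ hr0), C + r ^ (-(α : ℝ)),
      by positivity, ?_⟩
    intro p hp hpf
    set m := deriv g ((e * p).re)
    refine ⟨kwNormal e m, kwNormal_norm he m, fun w hw => ?_⟩
    have hk0 : |((w - p) * (starRingEnd ℂ) (kwNormal e m)).re| ≤ ‖w - p‖ := by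
      refine (Complex.abs_re_le_norm _).trans ?_
      rw [norm_mul, RCLike.norm_conj, kwNormal_norm he, mul_one]
    have hpn : 0 ≤ ‖w - p‖ ^ (1 + (α : ℝ)) := by positivity
    rw [add_mul]
    by_cases hwp : ‖w - p‖ < r
    · have hpU' : p ∈ U := hball (ball_subset_ball (by linarith) hp)
      have hwU : w ∈ U := by
        apply hball
        rw [mem_ball] at hp ⊢
        rw [← dist_eq_norm] at hwp
        have := dist_triangle w p p₀
        linarith
      have hgp := kw_graph hΩ hU hg.continuous hchart hpU' hpf
      have hgw := kw_graph hΩ hU hg.continuous hchart hwU hw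
      have h2 := kwNormal_re e (w - p) m
      rw [mul_sub, Complex.sub_im, Complex.sub_re, hgp, hgw] at h2
      have h1 := kw_taylor hg hh ((e * w).re) ((e * p).re)
      have h3 : |(e * w).re - (e * p).re| ≤ ‖w - p‖ := by
        rw [← Complex.sub_re, ← mul_sub]
        refine (Complex.abs_re_le_norm _).trans ?_
        rw [norm_mul, he, one_mul]
      have hs1 : 1 ≤ Real.sqrt (1 + m ^ 2) := by
        apply Real.one_le_sqrt.2; nlinarith
      have h4 : |((w - p) * (starRingEnd ℂ) (kwNormal e m)).re| ≤ C * ‖w - p‖ ^ (1 + (α : ℝ)) := by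
        calc _ ≤ |((w - p) * (starRingEnd ℂ) (kwNormal e m)).re| * Real.sqrt (1 + m ^ 2) :=
              le_mul_of_one_le_right (abs_nonneg _) hs1
          _ = |((w - p) * (starRingEnd ℂ) (kwNormal e m)).re * Real.sqrt (1 + m ^ 2)| := by
              rw [abs_mul, abs_of_nonneg (Real.sqrt_nonneg _)]
          _ ≤ C * |(e * w).re - (e * p).re| ^ (1 + (α : ℝ)) := by rw [h2]; exact h1
          _ ≤ _ := by gcongr
      have : 0 ≤ r ^ (-(α : ℝ)) * ‖w - p‖ ^ (1 + (α : ℝ)) := by positivity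
      linarith
    · push Not at hwp
      have hpos : 0 < ‖w - p‖ := hr0.trans_le hwp
      have h1 : ‖w - p‖ ≤ r ^ (-(α : ℝ)) * ‖w - p‖ ^ (1 + (α : ℝ)) := by
        rw [Real.rpow_add hpos, Real.rpow_one, Real.rpow_neg hr0.le]
        have h2 : r ^ (α : ℝ) ≤ ‖w - p‖ ^ (α : ℝ) := by gcongr
        have h3 : 0 < r ^ (α : ℝ) := by positivity
        rw [inv_mul_eq_div, le_div_iff₀ h3]
        gcongr
      have : 0 ≤ C * ‖w - p‖ ^ (1 + (α : ℝ)) := by positivity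
      linarith


lemma kw_pick {Ψ : ℂ → ℂ} {c : ℂ} {R : ℝ} (hR : 0 < R) (hd : DifferentiableOn ℂ Ψ (ball c R))
    (hb : ∀ z ∈ ball c R, ‖Ψ z‖ < 1) {z : ℂ} (hz : z ∈ ball c R) :
    (1 - ‖z - c‖ / R) * (1 - ‖Ψ c‖) / 4 ≤ 1 - ‖Ψ z‖ := by
  have hc : ‖Ψ c‖ < 1 := hb c (mem_ball_self hR)
  have hin : ∀ u ∈ ball (0:ℂ) 1, c + R * u ∈ ball c R := by
    intro u hu
    rw [mem_ball_zero_iff] at hu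
    rw [mem_ball_iff_norm, add_sub_cancel_left, norm_mul, Complex.norm_real, Real.norm_of_nonneg hR.le]
    nlinarith
  set G : ℂ → ℂ := fun u => kwMob (Ψ c) (Ψ (c + R * u)) with hG
  have hGd : DifferentiableOn ℂ G (ball 0 1) := by
    intro u hu
    apply DifferentiableAt.differentiableWithinAt
    have h1 := (hd.differentiableAt (isOpen_ball.mem_nhds (hin u hu)))
    have h2 : DifferentiableAt ℂ (fun u : ℂ => c + R * u) u := by fun_prop
    exact (kwMob_hasDerivAt hc (hb _ (hin u hu))).differentiableAt.comp u (h1.comp u h2)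
  have hmaps : MapsTo G (ball 0 1) (closedBall 0 1) := by
    intro u hu
    rw [mem_closedBall_zero_iff]
    exact (kwMob_norm_lt hc (hb _ (hin u hu))).le
  have hG0 : G 0 = 0 := by simp [hG, kwMob]
  have hRc : (R:ℂ) ≠ 0 := by exact_mod_cast hR.ne'
  set q := ‖z - c‖ / R with hq
  have hq0 : 0 ≤ q := by positivity
  have hq1 : q < 1 := by
    rw [hq, div_lt_one hR]; exact mem_ball_iff_norm.1 hz
  have hnorm : ‖(z - c) / R‖ = q := by
    rw [norm_div, Complex.norm_real, Real.norm_of_nonneg hR.le]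
  have key := Complex.norm_le_norm_of_mapsTo_ball hGd hmaps hG0 (by rw [hnorm]; exact hq1)
  have hcz : c + R * ((z - c) / R) = z := by field_simp; ring
  rw [hnorm] at key
  simp only [hG, hcz] at key
  have hzb := hb z hz
  have hden := kwMob_den_ne hc hzb
  rw [kwMob, norm_div, div_le_iff₀ (norm_pos_iff.2 hden)] at key
  have hid : ‖1 - (starRingEnd ℂ) (Ψ c) * Ψ z‖^2 - ‖Ψ z - Ψ c‖^2 = (1-‖Ψ c‖^2)*(1-‖Ψ z‖^2) := by
    simp only [Complex.sq_norm, Complex.normSq_apply, sub_re, sub_im, mul_re, mul_im, one_re, one_im,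
      conj_re, conj_im]
    ring
  have hlow : 1 - ‖Ψ c‖ ≤ ‖1 - (starRingEnd ℂ) (Ψ c) * Ψ z‖ := by
    have h1 := norm_sub_norm_le (1:ℂ) ((starRingEnd ℂ) (Ψ c) * Ψ z)
    rw [norm_one, norm_mul, Complex.norm_conj] at h1
    nlinarith [norm_nonneg (Ψ c), norm_nonneg (Ψ z)]
  set D := ‖1 - (starRingEnd ℂ) (Ψ c) * Ψ z‖
  set b := ‖Ψ c‖
  set x := ‖Ψ z‖
  have hb0 : 0 ≤ b := norm_nonneg _
  have hx0 : 0 ≤ x := norm_nonneg _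
  have h3 : ‖Ψ z - Ψ c‖^2 ≤ (q * D)^2 := pow_le_pow_left₀ (norm_nonneg _) key 2
  have h4 : (1 - q^2) * (1-b)^2 ≤ (1-b^2)*(1-x^2) := by
    have : (1-b)^2 ≤ D^2 := pow_le_pow_left₀ (by linarith) hlow 2
    have h0 : 0 ≤ 1 - q^2 := by nlinarith
    have h8 := mul_le_mul_of_nonneg_left this h0
    rw [mul_pow] at h3
    linarith
  have h5 : (1 - q^2) * (1-b) ≤ (1+b)*(1-x^2) := by
    have : (1-b) * ((1 - q^2) * (1-b)) ≤ (1-b) * ((1+b)*(1-x^2)) := by linarith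
    exact le_of_mul_le_mul_left this (by linarith)
  have h6 : (1 - q) * (1-b) ≤ (1 - q^2) * (1-b) := by
    apply mul_le_mul_of_nonneg_right _ (by linarith); nlinarith
  have h7 : (1+b)*(1-x^2) ≤ 2 * (2 * (1-x)) := by
    apply mul_le_mul (by linarith) (by nlinarith) (by nlinarith) (by norm_num)
  linarith

lemma kw_exit {Ω : Set ℂ} (hΩ : IsOpen Ω) {ζ ν : ℂ} {T : ℝ} (hT : 0 ≤ T) (hζ : ζ ∈ Ω)
    (h : ζ - T * ν ∉ Ω) : ∃ t : ℝ, 0 < t ∧ t ≤ T ∧ ζ - t * ν ∈ frontier Ω := by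
  have hcont : Continuous (fun t : ℝ => ζ - t * ν) := by fun_prop
  set S : Set ℝ := Icc 0 T ∩ (fun t : ℝ => ζ - t * ν) ⁻¹' Ωᶜ with hS
  have hSc : IsCompact S := isCompact_Icc.inter_right (hΩ.isClosed_compl.preimage hcont)
  obtain ⟨t, ht, hmin⟩ := hSc.exists_isLeast ⟨T, ⟨hT, le_rfl⟩, h⟩
  have ht0 : 0 < t := by
    rcases ht.1.1.lt_or_eq with h1 | h1
    · exact h1
    · exfalso; apply ht.2; rw [← h1]; simpa using hζ
  refine ⟨t, ht0, ht.1.2, ?_⟩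
  rw [hΩ.frontier_eq]
  refine ⟨?_, ht.2⟩
  have hcl : t ∈ closure (Ico 0 t) := by
    rw [closure_Ico ht0.ne]; exact ⟨ht0.le, le_rfl⟩
  refine map_mem_closure (f := fun t : ℝ => ζ - t * ν) hcont hcl ?_
  intro s hs
  by_contra hns
  have := hmin (show s ∈ S from ⟨⟨hs.1, hs.2.le.trans ht.1.2⟩, hns⟩)
  exact absurd hs.2 (not_lt.2 this)

lemma kw_sector {a : ℝ} (ha : 0 < a) (ha1 : a < 1) {ω : ℂ} (hω : 0 < ω.re) :
    Real.cos (a * (π/2)) / 2 * ‖ω ^ (a:ℂ)‖ < (ω ^ (a:ℂ)).re := by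
  have hω0 : ω ≠ 0 := by rintro rfl; simp at hω
  have hn : 0 < ‖ω‖ := norm_pos_iff.2 hω0
  rw [Complex.cpow_ofReal_re, Complex.norm_cpow_real, mul_comm]
  have hr : 0 < ‖ω‖ ^ a := Real.rpow_pos_of_pos hn a
  apply mul_lt_mul_of_pos_left _ hr
  have h1 : |arg ω| < π/2 := Complex.abs_arg_lt_pi_div_two_iff.2 (Or.inl hω)
  have h2 : 0 < Real.cos (a * (π/2)) := by
    apply Real.cos_pos_of_mem_Ioo
    constructor <;> nlinarith [Real.pi_pos]
  have h3 : Real.cos (a * (π/2)) ≤ Real.cos (arg ω * a) := by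
    rw [← Real.cos_abs (arg ω * a), abs_mul, abs_of_pos ha]
    apply Real.cos_le_cos_of_nonneg_of_le_pi (by positivity)
    · nlinarith [Real.pi_pos]
    · nlinarith
  linarith

lemma kw_local {Ω : Set ℂ} {α : ℝ≥0} (hΩ : IsOpen Ω) (hb : HasC1AlphaBoundary α Ω)
    {φ : ℂ → ℂ} (hφ : DifferentiableOn ℂ φ Ω) (hφ1 : ∀ z ∈ Ω, ‖φ z‖ < 1)
    {a : ℝ} (ha : 0 < a) (ha1 : a < 1) {p₀ : ℂ} (hp₀ : p₀ ∈ frontier Ω) :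
    ∃ d > 0, ∃ C : ℝ, 0 ≤ C ∧ ∀ ζ ∈ Ω, ζ ∈ ball p₀ d → ∃ p ∉ Ω, ‖ζ - p‖ ≤ C * (1 - ‖φ ζ‖)^a := by
  set η := Real.cos (a * (π/2)) / 2 with hη
  have hη0 : 0 < η := by
    have : 0 < Real.cos (a * (π/2)) := by
      apply Real.cos_pos_of_mem_Ioo
      constructor <;> nlinarith [Real.pi_pos]
    positivity
  have hη1 : η ≤ 1/2 := by have := Real.cos_le_one (a * (π/2)); rw [hη]; linarith
  obtain ⟨r, hr, ν, hν, hcone⟩ := kw_cone hΩ hb hp₀ hη0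
  have hνν : ν * (starRingEnd ℂ) ν = 1 := by
    rw [Complex.mul_conj, Complex.normSq_eq_norm_sq, hν]; simp
  -- choose R
  obtain ⟨R, hR, hRr⟩ : ∃ R : ℝ, 0 < R ∧ (2 * R) ^ a ≤ r / 2 := by
    refine ⟨(r/2)^(a⁻¹) / 2, by positivity, ?_⟩
    rw [mul_div_cancel₀ _ (two_ne_zero), ← Real.rpow_mul (by positivity), inv_mul_cancel₀ ha.ne',
      Real.rpow_one]
  have hsec : ∀ p ∈ frontier Ω, p ∈ closedBall p₀ (r/4) → ∀ ω ∈ ball (R:ℂ) R,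
      p + ν * ω ^ (a:ℂ) ∈ Ω := by
    intro p hp hpb ω hω
    have hre : 0 < ω.re := by
      have h1 := mem_ball_iff_norm.1 hω
      have h2 := abs_re_le_norm (ω - R)
      rw [sub_re, ofReal_re] at h2
      have := (abs_lt.1 (h2.trans_lt h1)).1
      linarith
    have hnω : ‖ω‖ < 2 * R := by
      have h1 := mem_ball_iff_norm.1 hω
      have h2 := norm_sub_norm_le ω (R:ℂ)
      rw [Complex.norm_real, Real.norm_of_nonneg hR.le] at h2
      linarith
    have hna : ‖ω ^ (a:ℂ)‖ ≤ r/2 := by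
      rw [Complex.norm_cpow_real]
      exact (Real.rpow_le_rpow (norm_nonneg _) hnω.le ha.le).trans hRr
    rw [mem_closedBall_iff_norm] at hpb
    refine (hcone p hp ?_ _ ?_).1 ?_
    · rw [mem_ball_iff_norm]; linarith
    · rw [mem_ball_iff_norm]
      have e : p + ν * ω ^ (a:ℂ) - p₀ = (p - p₀) + ν * ω ^ (a:ℂ) := by ring
      rw [e]
      refine (norm_add_le _ _).trans_lt ?_
      rw [norm_mul, hν, one_mul]; linarith
    · have e : (p + ν * ω ^ (a:ℂ) - p) * (starRingEnd ℂ) ν = ω ^ (a:ℂ) := by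
        rw [add_sub_cancel_left, mul_right_comm, hνν, one_mul]
      rw [e, add_sub_cancel_left, norm_mul, hν, one_mul]
      exact kw_sector ha ha1 hre
  -- compactness
  obtain ⟨ρ, hρ1, hρ⟩ : ∃ ρ < 1, ∀ p ∈ frontier Ω ∩ closedBall p₀ (r/4),
      ‖φ (p + ν * (R:ℂ) ^ (a:ℂ))‖ ≤ ρ := by
    have hK : IsCompact (frontier Ω ∩ closedBall p₀ (r/4)) :=
      (isCompact_closedBall p₀ (r/4)).inter_left isClosed_frontier
    have hne : (frontier Ω ∩ closedBall p₀ (r/4)).Nonempty :=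
      ⟨p₀, hp₀, mem_closedBall_self (by positivity)⟩
    have hin : ∀ p ∈ frontier Ω ∩ closedBall p₀ (r/4), p + ν * (R:ℂ) ^ (a:ℂ) ∈ Ω :=
      fun p hp => hsec p hp.1 hp.2 _ (mem_ball_self hR)
    have hcont : ContinuousOn (fun p => ‖φ (p + ν * (R:ℂ) ^ (a:ℂ))‖)
        (frontier Ω ∩ closedBall p₀ (r/4)) := by
      apply ContinuousOn.norm
      exact hφ.continuousOn.comp (by fun_prop) hin
    obtain ⟨p, hp, hmax⟩ := hK.exists_isMaxOn hne hcont
    exact ⟨_, hφ1 _ (hin p hp), fun q hq => hmax hq⟩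
  have hRa : 0 < R ^ a := Real.rpow_pos_of_pos hR a
  obtain ⟨d, hd, hdr, hdR⟩ : ∃ d : ℝ, 0 < d ∧ 20 * d ≤ r ∧ 4 * d < R ^ a := by
    refine ⟨min (r/20) (R^a/5), by positivity, ?_, ?_⟩
    · have := min_le_left (r/20) (R^a/5); linarith
    · have := min_le_right (r/20) (R^a/5); linarith
  refine ⟨d, hd, (4 * R / (1 - ρ)) ^ a, ?_, ?_⟩
  · apply Real.rpow_nonneg
    apply div_nonneg (by positivity) (by linarith)
  intro ζ hζ hζd
  rw [mem_ball_iff_norm] at hζd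
  have hout : ζ - ((4 * d : ℝ):ℂ) * ν ∉ Ω := by
    refine (hcone p₀ hp₀ (mem_ball_self hr) _ ?_).2 ?_
    · rw [mem_ball_iff_norm]
      have e : ζ - ((4 * d : ℝ):ℂ) * ν - p₀ = (ζ - p₀) - ((4 * d : ℝ):ℂ) * ν := by ring
      rw [e]
      refine (norm_sub_le _ _).trans_lt ?_
      rw [norm_mul, hν, mul_one, Complex.norm_real, Real.norm_of_nonneg (by positivity)]
      linarith
    · have e : ζ - ((4 * d : ℝ):ℂ) * ν - p₀ = (ζ - p₀) - ((4 * d : ℝ):ℂ) * ν := by ring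
      have e2 : (ζ - ((4 * d : ℝ):ℂ) * ν - p₀) * (starRingEnd ℂ) ν
          = (ζ - p₀) * (starRingEnd ℂ) ν - ((4 * d : ℝ):ℂ) := by
        rw [e, sub_mul, mul_assoc _ ν, hνν, mul_one]
      have h1 : ‖ζ - ((4 * d : ℝ):ℂ) * ν - p₀‖ ≤ 5 * d := by
        rw [e]
        refine (norm_sub_le _ _).trans ?_
        rw [norm_mul, hν, mul_one, Complex.norm_real, Real.norm_of_nonneg (by positivity)]
        linarith
      have h2 : ((ζ - p₀) * (starRingEnd ℂ) ν).re ≤ d := by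
        refine (re_le_norm _).trans ?_
        rw [norm_mul, Complex.norm_conj, hν, mul_one]; exact hζd.le
      rw [e2, sub_re, ofReal_re]
      have h3 : η * ‖ζ - ((4 * d : ℝ):ℂ) * ν - p₀‖ ≤ 1/2 * (5 * d) :=
        mul_le_mul hη1 h1 (norm_nonneg _) (by norm_num)
      linarith
  obtain ⟨t, ht0, htd, hfr⟩ := kw_exit hΩ (by positivity) hζ hout
  set p := ζ - t * ν with hp
  have hpΩ : p ∉ Ω := by rw [hΩ.frontier_eq] at hfr; exact hfr.2
  refine ⟨p, hpΩ, ?_⟩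
  have hpb : p ∈ closedBall p₀ (r/4) := by
    rw [mem_closedBall_iff_norm]
    have e : p - p₀ = (ζ - p₀) - t * ν := by rw [hp]; ring
    rw [e]
    refine (norm_sub_le _ _).trans ?_
    rw [norm_mul, hν, mul_one, Complex.norm_real, Real.norm_of_nonneg ht0.le]
    linarith
  have hdist : ‖ζ - p‖ = t := by
    rw [hp, sub_sub_cancel, norm_mul, hν, mul_one, Complex.norm_real, Real.norm_of_nonneg ht0.le]
  rw [hdist]
  set s : ℝ := t ^ a⁻¹ with hs
  have hs0 : 0 < s := Real.rpow_pos_of_pos ht0 _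
  have hsa : s ^ a = t := by
    rw [hs, ← Real.rpow_mul ht0.le, inv_mul_cancel₀ ha.ne', Real.rpow_one]
  have hsR : s < R := by
    by_contra hcon
    have := Real.rpow_le_rpow hR.le (not_lt.1 hcon) ha.le
    rw [hsa] at this; linarith
  have hsb : (s:ℂ) ∈ ball (R:ℂ) R := by
    rw [mem_ball_iff_norm, ← ofReal_sub, Complex.norm_real, Real.norm_eq_abs, abs_lt]
    constructor <;> linarith
  set Φ : ℂ → ℂ := fun ω => φ (p + ν * ω ^ (a:ℂ)) with hΦ
  have hΦd : DifferentiableOn ℂ Φ (ball (R:ℂ) R) := by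
    intro ω hω
    apply DifferentiableAt.differentiableWithinAt
    have h1 := hφ.differentiableAt (hΩ.mem_nhds (hsec p hfr hpb ω hω))
    have hre : 0 < ω.re := by
      have h1 := mem_ball_iff_norm.1 hω
      have h2 := abs_re_le_norm (ω - R)
      rw [sub_re, ofReal_re] at h2
      have := (abs_lt.1 (h2.trans_lt h1)).1
      linarith
    have h2 : DifferentiableAt ℂ (fun ω : ℂ => p + ν * ω ^ (a:ℂ)) ω := by
      have := ((hasDerivAt_id ω).cpow_const (c := (a:ℂ)) (Or.inl hre)).differentiableAt
      exact (this.const_mul ν).const_add p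
    exact h1.comp ω h2
  have hsch := kw_pick hR hΦd (fun ω hω => hφ1 _ (hsec p hfr hpb ω hω)) hsb
  have hΦs : Φ s = φ ζ := by
    simp only [hΦ]
    rw [← Complex.ofReal_cpow hs0.le, hsa, hp]
    congr 1; ring
  have hn : ‖(s:ℂ) - R‖ = R - s := by
    rw [← ofReal_sub, Complex.norm_real, Real.norm_eq_abs, abs_of_neg (by linarith)]; ring
  rw [hΦs, hn] at hsch
  have hρR := hρ p ⟨hfr, hpb⟩
  have e1 : 1 - (R - s) / R = s / R := by field_simp; ring
  rw [e1] at hsch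
  have hss : s ≤ 4 * R / (1 - ρ) * (1 - ‖φ ζ‖) := by
    have h1 : s / R * (1 - ρ) / 4 ≤ 1 - ‖φ ζ‖ := by
      refine le_trans ?_ hsch
      have : 0 ≤ s / R := by positivity
      have h2 : 1 - ρ ≤ 1 - ‖Φ R‖ := by linarith
      have := mul_le_mul_of_nonneg_left h2 this
      linarith
    have hρ' : 0 < 1 - ρ := by linarith
    have e2 : s = 4 * R / (1 - ρ) * (s / R * (1 - ρ) / 4) := by field_simp
    rw [e2]
    apply mul_le_mul_of_nonneg_left h1 (by positivity)
  have hC0 : 0 ≤ 4 * R / (1 - ρ) := div_nonneg (by positivity) (by linarith)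
  rw [← Real.mul_rpow hC0 (by linarith [hφ1 ζ hζ]), ← hsa]
  exact Real.rpow_le_rpow hs0.le hss ha.le

lemma kw_global {Ω : Set ℂ} {α : ℝ≥0} (hΩ : IsOpen Ω) (hbd : Bornology.IsBounded Ω)
    (hb : HasC1AlphaBoundary α Ω)
    {φ : ℂ → ℂ} (hφ : DifferentiableOn ℂ φ Ω) (hφ1 : ∀ z ∈ Ω, ‖φ z‖ < 1)
    {a : ℝ} (ha : 0 < a) (ha1 : a < 1) :
    ∃ C : ℝ, 0 ≤ C ∧ ∀ ζ ∈ Ω, ∃ p ∉ Ω, ‖ζ - p‖ ≤ C * (1 - ‖φ ζ‖)^a := by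
  have hcomp : IsCompact (closure Ω) := hbd.isCompact_closure
  obtain ⟨q, hq⟩ : ∃ q, q ∉ Ω := by
    by_contra hcon
    push Not at hcon
    have : Ω = univ := eq_univ_of_forall hcon
    rw [this] at hbd
    exact NormedSpace.unbounded_univ ℂ ℂ hbd
  have main : ∃ C : ℝ, 0 ≤ C ∧ ∀ ζ ∈ Ω, ζ ∈ closure Ω → ∃ p ∉ Ω, ‖ζ - p‖ ≤ C * (1 - ‖φ ζ‖)^a := by
    refine hcomp.induction_on (p := fun s => ∃ C : ℝ, 0 ≤ C ∧ ∀ ζ ∈ Ω, ζ ∈ s →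
      ∃ p ∉ Ω, ‖ζ - p‖ ≤ C * (1 - ‖φ ζ‖)^a) ?_ ?_ ?_ ?_
    · exact ⟨0, le_rfl, fun ζ _ h => absurd h (notMem_empty _)⟩
    · rintro s t hst ⟨C, hC, h⟩
      exact ⟨C, hC, fun ζ hζ hs => h ζ hζ (hst hs)⟩
    · rintro s t ⟨C, hC, h⟩ ⟨C', hC', h'⟩
      refine ⟨max C C', le_max_of_le_left hC, ?_⟩
      intro ζ hζ hst
      have hnn : 0 ≤ (1 - ‖φ ζ‖)^a := Real.rpow_nonneg (by linarith [hφ1 ζ hζ]) _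
      rcases hst with hs | ht
      · obtain ⟨p, hp, hle⟩ := h ζ hζ hs
        exact ⟨p, hp, hle.trans (mul_le_mul_of_nonneg_right (le_max_left _ _) hnn)⟩
      · obtain ⟨p, hp, hle⟩ := h' ζ hζ ht
        exact ⟨p, hp, hle.trans (mul_le_mul_of_nonneg_right (le_max_right _ _) hnn)⟩
    · intro x hx
      by_cases hxΩ : x ∈ Ω
      · set κ := (1 - ‖φ x‖) / 2 with hκ
        have hκ0 : 0 < κ := by have := hφ1 x hxΩ; rw [hκ]; linarith
        have hcx : ContinuousAt (fun z => 1 - ‖φ z‖) x :=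
          continuousAt_const.sub (hφ.differentiableAt (hΩ.mem_nhds hxΩ)).continuousAt.norm
        have hev : ∀ᶠ z in 𝓝 x, κ < 1 - ‖φ z‖ := by
          apply hcx.eventually (lt_mem_nhds _)
          have := hφ1 x hxΩ
          rw [hκ]; linarith
        have hev2 : ∀ᶠ z in 𝓝 x, z ∈ ball x 1 := ball_mem_nhds x one_pos
        refine ⟨_, mem_nhdsWithin_of_mem_nhds (hev.and hev2), (1 + ‖x - q‖) / κ ^ a, by positivity, ?_⟩
        rintro ζ hζ ⟨h1, h2⟩
        refine ⟨q, hq, ?_⟩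
        rw [mem_ball_iff_norm] at h2
        have h3 : ‖ζ - q‖ ≤ 1 + ‖x - q‖ := by
          have e : ζ - q = (ζ - x) + (x - q) := by ring
          rw [e]
          exact (norm_add_le _ _).trans (by linarith)
        have h4 : κ ^ a ≤ (1 - ‖φ ζ‖)^a := Real.rpow_le_rpow hκ0.le h1.le ha.le
        have h5 : 0 < κ ^ a := Real.rpow_pos_of_pos hκ0 a
        calc ‖ζ - q‖ ≤ 1 + ‖x - q‖ := h3
          _ = (1 + ‖x - q‖) / κ ^ a * κ ^ a := by field_simp
          _ ≤ _ := mul_le_mul_of_nonneg_left h4 (by positivity)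
      · have hfr : x ∈ frontier Ω := by rw [hΩ.frontier_eq]; exact ⟨hx, hxΩ⟩
        obtain ⟨d, hd, C, hC, h⟩ := kw_local hΩ hb hφ hφ1 ha ha1 hfr
        exact ⟨ball x d, mem_nhdsWithin_of_mem_nhds (ball_mem_nhds x hd), C, hC, h⟩
  obtain ⟨C, hC, h⟩ := main
  exact ⟨C, hC, fun ζ hζ => h ζ hζ (subset_closure hζ)⟩

lemma kw_deriv_bound {Ω : Set ℂ} {α : ℝ≥0} (hΩ : IsOpen Ω) (hbd : Bornology.IsBounded Ω)
    (hb : HasC1AlphaBoundary α Ω)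
    {φ f : ℂ → ℂ} (hφ : DifferentiableOn ℂ φ Ω) (hφ1 : ∀ z ∈ Ω, ‖φ z‖ < 1)
    (hf : DifferentiableOn ℂ f (ball 0 1)) (hfm : ∀ z ∈ ball (0:ℂ) 1, f z ∈ Ω)
    (hφf : ∀ z ∈ ball (0:ℂ) 1, φ (f z) = z) {γ : ℝ} (hγ : 0 < γ) (hγ1 : γ < 1) :
    ∃ C : ℝ, 0 ≤ C ∧ ∀ z ∈ ball (0:ℂ) 1, ‖deriv f z‖ ≤ C * (1 - ‖z‖) ^ (γ - 1) := by
  set a := Real.sqrt γ with hadef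
  have ha : 0 < a := Real.sqrt_pos.2 hγ
  have haa : a * a = γ := Real.mul_self_sqrt hγ.le
  have ha1 : a < 1 := by nlinarith
  obtain ⟨C, hC, hglob⟩ := kw_global hΩ hbd hb hφ hφ1 ha ha1
  obtain ⟨B, hB⟩ := hbd.exists_norm_le
  have hB0 : 0 ≤ B := (norm_nonneg _).trans (hB _ (hfm 0 (mem_ball_self one_pos)))
  set M := 2 * B + C + 1 with hM
  have hM0 : 0 < M := by positivity
  set s := 1 - a with hs
  have hs0 : 0 < s := by rw [hs]; linarith
  refine ⟨C ^ a * M ^ s * 2 / s, by positivity, ?_⟩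
  intro z hz
  have hz1 : ‖z‖ < 1 := mem_ball_zero_iff.1 hz
  set δ := 1 - ‖z‖ with hδ
  have hδ0 : 0 < δ := by rw [hδ]; linarith
  have hδ1 : δ ≤ 1 := by rw [hδ]; linarith [norm_nonneg z]
  obtain ⟨p, hp, hpz⟩ := hglob (f z) (hfm z hz)
  rw [hφf z hz] at hpz
  have hne : ∀ w ∈ ball (0:ℂ) 1, f w - p ≠ 0 := by
    intro w hw h0
    apply hp
    rw [← sub_eq_zero.1 h0]; exact hfm w hw
  have hsc : IsSimplyConnected (ball (0:ℂ) 1) := by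
    have hcv : Convex ℝ (ball (0:ℂ) 1) := convex_ball 0 1
    have : ContractibleSpace (ball (0:ℂ) 1) := hcv.contractibleSpace ⟨0, mem_ball_self one_pos⟩
    exact SimplyConnectedSpace.ofContractible _
  obtain ⟨L, hL, hLe⟩ := kw_log isOpen_ball hsc (hf.sub_const p) hne
  set h : ℂ → ℂ := fun w => exp (s * L w) with hh
  have hhn : ∀ w ∈ ball (0:ℂ) 1, ‖h w‖ = ‖f w - p‖ ^ s := by
    intro w hw
    rw [← hLe w hw, Complex.norm_exp, Complex.norm_exp, ← Real.exp_mul]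
    congr 1
    simp [mul_comm]
  have hbig : ∀ w ∈ ball (0:ℂ) 1, ‖h w‖ ≤ M ^ s := by
    intro w hw
    rw [hhn w hw]
    apply Real.rpow_le_rpow (norm_nonneg _) _ hs0.le
    have e : f w - p = (f w - f z) + (f z - p) := by ring
    rw [e]
    have h1 := hB _ (hfm w hw)
    have h2 := hB _ (hfm z hz)
    have h3 : C * δ ^ a ≤ C := by
      have := Real.rpow_le_one hδ0.le hδ1 ha.le
      nlinarith
    have h4 := norm_add_le (f w - f z) (f z - p)
    have h5 := norm_sub_le (f w) (f z)
    rw [hM]; linarith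
  have hLz := (hL.differentiableAt (isOpen_ball.mem_nhds hz)).hasDerivAt
  have hhd : HasDerivAt h (exp (s * L z) * (s * deriv L z)) z := (hLz.const_mul (s:ℂ)).cexp
  have hhdo : DifferentiableOn ℂ h (ball 0 1) := (hL.const_mul (s:ℂ)).cexp
  have hfL : deriv f z = (f z - p) * deriv L z := by
    have h1 : HasDerivAt (fun w => exp (L w)) (exp (L z) * deriv L z) z := hLz.cexp
    have h2 : HasDerivAt (fun w => f w - p) (deriv f z) z :=
      (hf.differentiableAt (isOpen_ball.mem_nhds hz)).hasDerivAt.sub_const p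
    have h3 : (fun w => f w - p) =ᶠ[𝓝 z] fun w => exp (L w) := by
      filter_upwards [isOpen_ball.mem_nhds hz] with w hw using (hLe w hw).symm
    rw [← hLe z hz]
    exact h2.unique (h1.congr_of_eventuallyEq h3)
  have hsub : closedBall z (δ/2) ⊆ ball (0:ℂ) 1 := by
    intro w hw
    rw [mem_closedBall_iff_norm] at hw
    rw [mem_ball_zero_iff]
    have e : w = (w - z) + z := by ring
    rw [e]
    refine (norm_add_le _ _).trans_lt ?_
    linarith
  have hcau := norm_deriv_le_of_forall_mem_sphere_norm_le (half_pos hδ0)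
    (hhdo.diffContOnCl_ball hsub) (fun w hw => hbig w (hsub (sphere_subset_closedBall hw)))
  rw [hhd.deriv] at hcau
  have hN0 : 0 < ‖f z - p‖ := norm_pos_iff.2 (hne z hz)
  have hcau2 : ‖f z - p‖ ^ s * (s * ‖deriv L z‖) ≤ M ^ s / (δ/2) := by
    rw [← hhn z hz]
    refine le_trans (le_of_eq ?_) hcau
    rw [norm_mul, norm_mul, Complex.norm_real, Real.norm_of_nonneg hs0.le]
  rw [hfL, norm_mul]
  have hsplit : ‖f z - p‖ = ‖f z - p‖ ^ a * ‖f z - p‖ ^ s := by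
    rw [← Real.rpow_add hN0, hs]; simp
  have hpa : ‖f z - p‖ ^ a ≤ C ^ a * δ ^ γ := by
    rw [← haa, Real.rpow_mul hδ0.le, ← Real.mul_rpow hC (by positivity)]
    exact Real.rpow_le_rpow hN0.le hpz ha.le
  have hLs : ‖f z - p‖ ^ s * ‖deriv L z‖ ≤ M ^ s / (δ/2) / s := by
    rw [le_div_iff₀ hs0]; linarith
  calc ‖f z - p‖ * ‖deriv L z‖ = ‖f z - p‖ ^ a * (‖f z - p‖ ^ s * ‖deriv L z‖) := by
        conv_lhs => rw [hsplit]
        ring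
    _ ≤ (C ^ a * δ ^ γ) * (M ^ s / (δ/2) / s) :=
        mul_le_mul hpa hLs (by positivity) (by positivity)
    _ = _ := by
        rw [Real.rpow_sub hδ0, Real.rpow_one]; field_simp


lemma kw_bdry_frontier {Ω : Set ℂ} (hΩ : IsOpen Ω) {φ F : ℂ → ℂ} (hφ : DifferentiableOn ℂ φ Ω)
    (hφ1 : ∀ z ∈ Ω, ‖φ z‖ < 1) (hF : ContinuousOn F (closedBall 0 1))
    (hFm : ∀ z ∈ ball (0:ℂ) 1, F z ∈ Ω) (hφF : ∀ z ∈ ball (0:ℂ) 1, φ (F z) = z)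
    {e : ℂ} (he : ‖e‖ = 1) : F e ∈ frontier Ω := by
  have hec : e ∈ closedBall (0:ℂ) 1 := by simp [he]
  have hecl : e ∈ closure (ball (0:ℂ) 1) := by rw [closure_ball _ one_ne_zero]; exact hec
  have hcw : ContinuousWithinAt F (ball 0 1) e := (hF e hec).mono ball_subset_closedBall
  rw [hΩ.frontier_eq]
  refine ⟨hcw.mem_closure hecl hFm, fun hcon => ?_⟩
  have := mem_closure_iff_nhdsWithin_neBot.1 hecl
  have h1 : Tendsto (fun z => φ (F z)) (𝓝[ball 0 1] e) (𝓝 (φ (F e))) :=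
    (hφ.differentiableAt (hΩ.mem_nhds hcon)).continuousAt.tendsto.comp hcw
  have h2 : Tendsto (fun z => φ (F z)) (𝓝[ball 0 1] e) (𝓝 e) := by
    have h3 : Tendsto (fun z : ℂ => z) (𝓝[ball 0 1] e) (𝓝 e) := tendsto_id.mono_left nhdsWithin_le_nhds
    refine h3.congr' ?_
    filter_upwards [self_mem_nhdsWithin] with z hz using (hφF z hz).symm
  have h4 := hφ1 _ hcon
  rw [tendsto_nhds_unique h1 h2, he] at h4
  exact lt_irrefl _ h4

lemma kw_second_deriv {Ω : Set ℂ} {α : ℝ≥0} (hα : 0 < α) (hα1 : α ≤ 1) (hΩ : IsOpen Ω)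
    (hbd : Bornology.IsBounded Ω) (hb : HasC1AlphaBoundary α Ω) {F : ℂ → ℂ}
    (hF : ContinuousOn F (closedBall 0 1)) (hFd : DifferentiableOn ℂ F (ball 0 1))
    (hfr : ∀ e : ℂ, ‖e‖ = 1 → F e ∈ frontier Ω) {H γ β : ℝ} (hH : 0 ≤ H)
    (hβ : 0 < β) (hβ1 : β < 1) (hγβ : γ * (1 + (α:ℝ)) = 1 + β)
    (hHol : ∀ z ∈ closedBall (0 : ℂ) 1, ∀ w ∈ closedBall (0 : ℂ) 1,
      ‖F z - F w‖ ≤ H * ‖z - w‖ ^ γ) :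
    ∃ C : ℝ, 0 ≤ C ∧ ∀ z ∈ ball (0:ℂ) 1, ‖deriv (deriv F) z‖ ≤ C * (1 - ‖z‖) ^ (β - 1) := by
  obtain ⟨C₁, hC₁, hcore⟩ := kw_core β hβ hβ1
  obtain ⟨C₂, hC₂, hflat⟩ := kw_flat hα hΩ hbd hb
  have hα0 : 0 ≤ (α:ℝ) := α.2
  refine ⟨C₁ * (C₂ * H ^ (1 + (α:ℝ))), by positivity, ?_⟩
  intro z hz
  have hz1 : ‖z‖ < 1 := mem_ball_zero_iff.1 hz
  obtain ⟨e, he, hez⟩ : ∃ e : ℂ, ‖e‖ = 1 ∧ e * (‖z‖ : ℂ) = z := by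
    by_cases h0 : z = 0
    · exact ⟨1, norm_one, by simp [h0]⟩
    · have hn : (‖z‖ : ℂ) ≠ 0 := by exact_mod_cast (norm_ne_zero_iff.2 h0)
      refine ⟨z / ‖z‖, ?_, by field_simp⟩
      rw [norm_div, Complex.norm_real, norm_norm, div_self (norm_ne_zero_iff.2 h0)]
  obtain ⟨ν, hν, hfl⟩ := hflat (F e) (hfr e he)
  set G : ℂ → ℂ := fun w => (F (e * w) - F e) * (starRingEnd ℂ) ν with hG
  have hmapb : ∀ w ∈ ball (0:ℂ) 1, e * w ∈ ball (0:ℂ) 1 := by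
    intro w hw; rw [mem_ball_zero_iff] at hw ⊢; rw [norm_mul, he, one_mul]; exact hw
  have hmapc : ∀ w ∈ closedBall (0:ℂ) 1, e * w ∈ closedBall (0:ℂ) 1 := by
    intro w hw; rw [mem_closedBall_zero_iff] at hw ⊢; rw [norm_mul, he, one_mul]; exact hw
  have hec : e ∈ closedBall (0:ℂ) 1 := by simp [he]
  have hlin : ∀ w, HasDerivAt (fun w : ℂ => e * w) e w := by
    intro w; simpa using (hasDerivAt_id w).const_mul e
  have hGd : ∀ w ∈ ball (0:ℂ) 1, HasDerivAt G (deriv F (e * w) * e * (starRingEnd ℂ) ν) w := by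
    intro w hw
    have h1 := (hFd.differentiableAt (isOpen_ball.mem_nhds (hmapb w hw))).hasDerivAt
    exact ((h1.comp w (hlin w)).sub_const (F e)).mul_const _
  have hGdc : DiffContOnCl ℂ G (ball 0 1) := by
    refine ⟨fun w hw => (hGd w hw).differentiableAt.differentiableWithinAt, ?_⟩
    rw [closure_ball _ one_ne_zero]
    exact ((hF.comp (by fun_prop) hmapc).sub continuousOn_const).mul continuousOn_const
  have hGb : ∀ t : ℝ, |(G (circleMap 0 1 t)).re| ≤
      (C₂ * H ^ (1 + (α:ℝ))) * ‖circleMap 0 1 t - 1‖ ^ (1 + β) := by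
    intro t
    have hn := kw_norm_circle t
    have h1 := hfl (F (e * circleMap 0 1 t)) (hfr _ (by rw [norm_mul, he, hn, one_mul]))
    refine h1.trans ?_
    rw [mul_assoc]
    apply mul_le_mul_of_nonneg_left _ hC₂
    have h2 := hHol (e * circleMap 0 1 t) (hmapc _ (by simp [hn])) e hec
    have e3 : e * circleMap 0 1 t - e = e * (circleMap 0 1 t - 1) := by ring
    rw [e3, norm_mul, he, one_mul] at h2
    have h4 := Real.rpow_le_rpow (norm_nonneg _) h2 (show 0 ≤ 1 + (α:ℝ) by positivity)
    rwa [Real.mul_rpow hH (by positivity), ← Real.rpow_mul (norm_nonneg _), hγβ] at h4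
  have key := hcore G _ (by positivity) hGdc hGb ‖z‖ (norm_nonneg _) hz1
  have hrb : ((‖z‖:ℝ):ℂ) ∈ ball (0:ℂ) 1 := by
    rw [mem_ball_zero_iff, Complex.norm_real, norm_norm]; exact hz1
  have hdd : deriv (deriv G) ((‖z‖:ℝ):ℂ) = deriv (deriv F) z * e * e * (starRingEnd ℂ) ν := by
    have h1 : deriv G =ᶠ[𝓝 ((‖z‖:ℝ):ℂ)] fun w => deriv F (e * w) * e * (starRingEnd ℂ) ν := by
      filter_upwards [isOpen_ball.mem_nhds hrb] with w hw using (hGd w hw).deriv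
    rw [h1.deriv_eq]
    have h2 : DifferentiableAt ℂ (deriv F) z :=
      (hFd.deriv isOpen_ball).differentiableAt (isOpen_ball.mem_nhds hz)
    have h3 : HasDerivAt (deriv F) (deriv (deriv F) z) (e * ((‖z‖:ℝ):ℂ)) := by
      rw [hez]; exact h2.hasDerivAt
    exact (((h3.comp _ (hlin _)).mul_const e).mul_const _).deriv
  rw [hdd] at key
  simpa [norm_mul, he, hν] using key

theorem kw_exists_param {Ω : Set ℂ} {α : ℝ≥0} (hα : 0 < α) (hα1 : α ≤ 1) (hΩ : IsOpen Ω)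
    (hbd : Bornology.IsBounded Ω) (hsc : IsSimplyConnected Ω) (hb : HasC1AlphaBoundary α Ω) :
    ∃ x₀ ∈ Ω, ∃ F F' : ℂ → ℂ, (∀ z ∈ ball (0 : ℂ) 1, HasDerivAt F (F' z) z) ∧
      ContinuousOn F (closedBall (0 : ℂ) 1) ∧
      ContinuousOn F' (closedBall (0 : ℂ) 1) ∧
      InjOn F (ball (0 : ℂ) 1) ∧
      F '' (ball (0 : ℂ) 1) = Ω ∧
      F 0 = x₀ := by
  obtain ⟨φ, f, hφ, hf, hφ1, hfφ, hfm, hφf⟩ := kw_riemann hΩ hbd hsc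
  have hα0 : 0 < (α:ℝ) := by exact_mod_cast hα
  have hα1' : (α:ℝ) ≤ 1 := by exact_mod_cast hα1
  set β : ℝ := α / 2 with hβ
  set γ : ℝ := (1 + β) / (1 + α) with hγ
  have hβ0 : 0 < β := by positivity
  have hβ1 : β < 1 := by rw [hβ]; linarith
  have hγ0 : 0 < γ := by positivity
  have hγ1 : γ < 1 := by rw [hγ, div_lt_one (by positivity), hβ]; linarith
  have hγβ : γ * (1 + (α:ℝ)) = 1 + β := by rw [hγ]; field_simp
  obtain ⟨C, hC, hdf⟩ := kw_deriv_bound hΩ hbd hb hφ hφ1 hf hfm hφf hγ0 hγ1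
  obtain ⟨F, hFc, hFf, hFh⟩ := kw_extend hγ0 (by positivity)
    (kw_hardy_littlewood hf hC hγ0 hγ1.le hdf)
  have hFm : ∀ z ∈ ball (0:ℂ) 1, F z ∈ Ω := fun z hz => by rw [hFf z hz]; exact hfm z hz
  have hφF : ∀ z ∈ ball (0:ℂ) 1, φ (F z) = z := fun z hz => by rw [hFf z hz]; exact hφf z hz
  have hFd : DifferentiableOn ℂ F (ball 0 1) := hf.congr hFf
  have hfr : ∀ e : ℂ, ‖e‖ = 1 → F e ∈ frontier Ω := fun e he =>
    kw_bdry_frontier hΩ hφ hφ1 hFc hFm hφF he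
  obtain ⟨C', hC', hdd⟩ := kw_second_deriv hα hα1 hΩ hbd hb hFc hFd hfr (by positivity) hβ0 hβ1 hγβ hFh
  obtain ⟨F', hF'c, hF'f, -⟩ := kw_extend hβ0 (by positivity)
    (kw_hardy_littlewood (hFd.deriv isOpen_ball) hC' hβ0 hβ1.le hdd)
  refine ⟨F 0, hFm 0 (mem_ball_self one_pos), F, F', ?_, hFc, hF'c, ?_, ?_, rfl⟩
  · intro z hz
    rw [hF'f z hz]
    exact (hFd.differentiableAt (isOpen_ball.mem_nhds hz)).hasDerivAt
  · intro x hx y hy hxy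
    rw [← hφF x hx, ← hφF y hy, hxy]
  · apply Subset.antisymm
    · rintro _ ⟨z, hz, rfl⟩; exact hFm z hz
    · intro w hw
      have hw1 : φ w ∈ ball (0:ℂ) 1 := mem_ball_zero_iff.2 (hφ1 w hw)
      exact ⟨φ w, hw1, by rw [hFf _ hw1, hfφ w hw]⟩

lemma kw_member_ge {Ω : Set ℂ} {x₀ : ℂ} {f f' : ℂ → ℂ} (h : IsConformalParam Ω x₀ f f') :
    Real.sqrt ((volume Ω).toReal / π) ≤
      Real.sqrt ((2 * π)⁻¹ * ∫ z in sphere (0 : ℂ) 1, ‖f' z‖ ^ 2 ∂(μH[1])) := by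
  obtain ⟨h1, -, h3, h4, h5, -⟩ := h
  have := kw_area h1 h3 h4
  rw [h5] at this
  apply Real.sqrt_le_sqrt
  have hπ := Real.pi_pos
  rw [div_le_iff₀ hπ]
  refine this.trans (le_of_eq ?_)
  field_simp

lemma kw_bdry_ge {Ω : Set ℂ} (hne : ∃ x₀ ∈ Ω, ∃ f f' : ℂ → ℂ, IsConformalParam Ω x₀ f f') :
    Real.sqrt ((volume Ω).toReal / π) ≤ bdryDistortion Ω := by
  obtain ⟨x₀, hx₀, f, f', h⟩ := hne
  apply le_csInf
  · exact ⟨_, x₀, hx₀, f, f', h, rfl⟩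
  · rintro r ⟨y, hy, g, g', hg, rfl⟩
    exact kw_member_ge hg

lemma kw_disc_le (c : ℂ) {R : ℝ} (hR : 0 < R) : bdryDistortion (ball c R) ≤ R := by
  apply csInf_le
  · refine ⟨0, ?_⟩
    rintro r ⟨y, hy, g, g', hg, rfl⟩
    exact Real.sqrt_nonneg _
  · refine ⟨c, mem_ball_self hR, fun z => c + R * z, fun _ => R, ⟨?_, ?_, ?_, ?_, ?_, ?_⟩, ?_⟩
    · intro z _
      simpa using ((hasDerivAt_id z).const_mul (R:ℂ)).const_add c
    · fun_prop
    · fun_prop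
    · intro x _ y _ hxy
      have hRc : (R:ℂ) ≠ 0 := by exact_mod_cast hR.ne'
      exact mul_left_cancel₀ hRc (add_left_cancel hxy)
    · have hRc : (R:ℂ) ≠ 0 := by exact_mod_cast hR.ne'
      apply Subset.antisymm
      · rintro _ ⟨z, hz, rfl⟩
        rw [mem_ball_zero_iff] at hz
        rw [mem_ball_iff_norm, add_sub_cancel_left, norm_mul, Complex.norm_real,
          Real.norm_of_nonneg hR.le]
        nlinarith
      · intro w hw
        rw [mem_ball_iff_norm] at hw
        refine ⟨(w - c) / R, ?_, by field_simp; ring⟩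
        rw [mem_ball_zero_iff, norm_div, Complex.norm_real, Real.norm_of_nonneg hR.le,
          div_lt_one hR]
        exact hw
    · simp
    · rw [kw_hausdorff_integral (fun _ => ‖(R:ℂ)‖ ^ 2) continuousOn_const]
      have hπ := Real.pi_pos
      have e : (2 * π)⁻¹ * ∫ _ in Ioc 0 (2 * π), ‖(R:ℂ)‖ ^ 2 = R ^ 2 := by
        rw [setIntegral_const, Complex.norm_real, Real.norm_of_nonneg hR.le, smul_eq_mul,
          Real.volume_real_Ioc_of_le (by positivity)]
        field_simp
        ring
      rw [e, Real.sqrt_sq hR.le]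

/-- Lemma 5.3: for a bounded simply connected planar set with `C^{1,α}` boundary,
`|Ω| ≤ π R̊_Ω²`; moreover, if `Ω` is a disk of radius `R` then `R̊_Ω = R` and equality
holds. -/
theorem area_le_pi_boundary_distortion_sq
    (Ω : Set ℂ) (hΩo : IsOpen Ω) (hΩb : Bornology.IsBounded Ω) (hΩne : Ω.Nonempty)
    (hΩproper : Ω ≠ univ) (hsc : SimplyConnectedSpace Ω)
    (α : ℝ≥0) (hα : 0 < α) (hα1 : α ≤ 1) (hbdry : HasC1AlphaBoundary α Ω) :
    (volume Ω).toReal ≤ π * bdryDistortion Ω ^ 2 ∧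
    ∀ (c : ℂ) (R : ℝ), 0 < R → Ω = ball c R →
      bdryDistortion Ω = R ∧ (volume Ω).toReal = π * bdryDistortion Ω ^ 2 := by
  have hex : ∃ x₀ ∈ Ω, ∃ f f' : ℂ → ℂ, IsConformalParam Ω x₀ f f' :=
    kw_exists_param hα hα1 hΩo hΩb hsc hbdry
  have hge := kw_bdry_ge hex
  have hπ := Real.pi_pos
  have hle : (volume Ω).toReal ≤ π * bdryDistortion Ω ^ 2 := by
    have h1 := pow_le_pow_left₀ (Real.sqrt_nonneg _) hge 2
    rw [Real.sq_sqrt (by positivity), div_le_iff₀ hπ] at h1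
    linarith
  refine ⟨hle, ?_⟩
  intro c R hR hΩR
  have hvol : (volume Ω).toReal = π * R ^ 2 := by
    rw [hΩR, Complex.volume_ball, ENNReal.toReal_mul, ENNReal.toReal_pow,
      ENNReal.toReal_ofReal hR.le, ENNReal.coe_toReal, NNReal.coe_real_pi]
    ring
  have heq : bdryDistortion Ω = R := by
    apply le_antisymm
    · rw [hΩR]; exact kw_disc_le c hR
    · rw [hvol, mul_div_cancel_left₀ _ hπ.ne', Real.sqrt_sq hR.le] at hge
      exact hge
  exact ⟨heq, by rw [hvol, heq]⟩
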